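/- arXiv:1301.5297 — 4 statements merged into one kernel-verified Lean document; each statement's English description precedes it below -/
import Mathlib

section
/- Let K be a compact metrizable space, D a discrete space, and X ⊆ K × αD a closed subspace. If the section X_∞ = {x ∈ K : (x,∞) ∈ X} is zero-dimensional, then X is supercompact. -/
open Set Topology TopologicalSpace

universe u v

/-- A topological space is *supercompact* if it has a subbase `S` for its topology such that
every cover of the space by members of `S` has a subcover with at most two members. -/
def IsSupercompact (X : Type*) [t : TopologicalSpace X] : Prop :=
  ∃ S : Set (Set X), TopologicalSpace.generateFrom S = t ∧
    ∀ C ⊆ S, ⋃₀ C = univ → ∃ T ⊆ C, T.Finite ∧ T.ncard ≤ 2 ∧ ⋃₀ T = univ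

open Filter

/-- A family of sets is *binary* if every nonempty linked subfamily has a common point. -/
def IsBinary {X : Type*} (𝒮 : Set (Set X)) : Prop :=
  ∀ L ⊆ 𝒮, L.Nonempty → (∀ A ∈ L, ∀ B ∈ L, (A ∩ B).Nonempty) → (⋂₀ L).Nonempty

/-- Every point of `Y` can be separated from the complement of each of its neighbourhoods by
finitely many members of `𝒮` avoiding the point. -/
def IsClosedSubbaseOn {X : Type*} [TopologicalSpace X] (𝒮 : Set (Set X)) (Y : Set X) : Prop :=
  ∀ x ∈ Y, ∀ U, IsOpen U → x ∈ U → ∃ 𝒜 ⊆ 𝒮, 𝒜.Finite ∧ x ∉ ⋃₀ 𝒜 ∧ Y \ U ⊆ ⋃₀ 𝒜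

theorem IsBinary.isSupercompact {X : Type*} [t : TopologicalSpace X] {𝒮 : Set (Set X)}
    (hc : ∀ A ∈ 𝒮, IsClosed A) (hb : IsBinary 𝒮) (hs : IsClosedSubbaseOn 𝒮 univ) :
    IsSupercompact X := by
  refine ⟨compl '' 𝒮, le_antisymm ?_ ?_, ?_⟩
  · intro U hU
    refine (@isOpen_iff_forall_mem_open X (generateFrom (compl '' 𝒮)) U).2 fun x hx => ?_
    obtain ⟨𝒜, h𝒜, hfin, hxA, hUA⟩ := hs x (mem_univ x) U hU hx
    refine ⟨⋂ A ∈ 𝒜, Aᶜ, fun y hy => ?_, ?_, ?_⟩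
    · by_contra hyU
      obtain ⟨A, hA, hyA⟩ := hUA ⟨mem_univ y, hyU⟩
      exact mem_iInter₂.1 hy A hA hyA
    · exact @Set.Finite.isOpen_biInter X _ (generateFrom (compl '' 𝒮)) _ _ hfin
        fun A hA => isOpen_generateFrom_of_mem ⟨A, h𝒜 hA, rfl⟩
    · exact mem_iInter₂.2 fun A hA hxA' => hxA ⟨A, hA, hxA'⟩
  · refine le_generateFrom ?_
    rintro _ ⟨A, hA, rfl⟩
    exact (hc A hA).isOpen_compl
  · intro C hC hcov
    rcases C.eq_empty_or_nonempty with rfl | ⟨c, hc'⟩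
    · exact ⟨∅, Subset.rfl, finite_empty, by simp, hcov⟩
    by_contra! hT
    have hlink : ∀ A ∈ compl '' C, ∀ B ∈ compl '' C, (A ∩ B).Nonempty := by
      rintro _ ⟨A, hA, rfl⟩ _ ⟨B, hB, rfl⟩
      by_contra hAB
      refine hT {A, B} (by simp [insert_subset_iff, hA, hB]) (by simp)
        ((ncard_insert_le A {B}).trans (by simp)) ?_
      rw [sUnion_pair, ← compl_empty_iff, compl_union]
      exact not_nonempty_iff_eq_empty.1 hAB
    have hsub : compl '' C ⊆ 𝒮 := by
      rintro _ ⟨A, hA, rfl⟩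
      obtain ⟨B, hB, rfl⟩ := hC hA
      simpa using hB
    obtain ⟨x, hx⟩ := hb _ hsub ⟨_, mem_image_of_mem _ hc'⟩ hlink
    obtain ⟨A, hA, hxA⟩ : x ∈ ⋃₀ C := hcov ▸ mem_univ x
    exact hx _ (mem_image_of_mem _ hA) hxA

theorem nonempty_sInter_of_chain {X : Type*} [TopologicalSpace X] [CompactSpace X]
    {L : Set (Set X)} (hL : L.Nonempty) (hc : ∀ A ∈ L, IsClosed A) (hne : ∀ A ∈ L, A.Nonempty)
    (hchain : ∀ A ∈ L, ∀ B ∈ L, A ⊆ B ∨ B ⊆ A) : (⋂₀ L).Nonempty := by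
  have := hL.to_subtype
  refine IsCompact.nonempty_sInter_of_directed_nonempty_isCompact_isClosed
    (fun A hA B hB => ?_) hne (fun A hA => (hc A hA).isCompact) hc
  rcases hchain A hA B hB with h | h
  · exact ⟨A, hA, Subset.rfl, h⟩
  · exact ⟨B, hB, h, Subset.rfl⟩

/-- Finitely many closed sets can be fattened without leaving prescribed open neighbourhoods and
without creating new intersections. -/
theorem exists_closed_swelling {X ι : Type*} [MetricSpace X] [CompactSpace X] {I : Set ι}
    (hI : I.Finite) (N O : ι → Set X) (hN : ∀ i ∈ I, IsClosed (N i))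
    (hO : ∀ i ∈ I, IsOpen (O i)) (hNO : ∀ i ∈ I, N i ⊆ O i) :
    ∃ M : ι → Set X, ∀ i ∈ I, IsClosed (M i) ∧ N i ⊆ interior (M i) ∧ M i ⊆ O i ∧
      ∀ j ∈ I, (M i ∩ M j).Nonempty → (N i ∩ N j).Nonempty := by
  have h1 : ∀ i ∈ I, ∀ᶠ δ in 𝓝[>] (0 : ℝ), Metric.cthickening δ (N i) ⊆ O i := by
    intro i hi
    obtain ⟨δ, hδ, h⟩ := (hN i hi).isCompact.exists_cthickening_subset_open (hO i hi) (hNO i hi)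
    filter_upwards [Ioc_mem_nhdsGT hδ] with r hr
    exact (Metric.cthickening_mono hr.2 _).trans h
  have h2 : ∀ i ∈ I, ∀ j ∈ I, ∀ᶠ δ in 𝓝[>] (0 : ℝ),
      (Metric.cthickening δ (N i) ∩ Metric.cthickening δ (N j)).Nonempty →
        (N i ∩ N j).Nonempty := by
    intro i hi j hj
    by_cases hij : (N i ∩ N j).Nonempty
    · exact Eventually.of_forall fun _ _ => hij
    obtain ⟨δ, hδ, h⟩ := (disjoint_iff_inter_eq_empty.2
      (not_nonempty_iff_eq_empty.1 hij)).exists_cthickenings (hN i hi).isCompact (hN j hj)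
    filter_upwards [Ioc_mem_nhdsGT hδ] with r hr hne
    exact absurd (h.mono (Metric.cthickening_mono hr.2 _) (Metric.cthickening_mono hr.2 _))
      (not_disjoint_iff_nonempty_inter.2 hne)
  obtain ⟨δ, hδ, h1, h2⟩ := ((eventually_mem_nhdsWithin (a := (0 : ℝ)) (s := Ioi 0)).and
    ((hI.eventually_all.2 h1).and (hI.eventually_all.2 fun i hi =>
      hI.eventually_all.2 (h2 i hi)))).exists
  refine ⟨fun i => Metric.cthickening δ (N i), fun i hi =>
    ⟨Metric.isClosed_cthickening, ?_, h1 i hi, h2 i hi⟩⟩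
  exact (Metric.self_subset_thickening hδ _).trans
    (interior_maximal (Metric.thickening_subset_cthickening _ _) Metric.isOpen_thickening)

theorem exists_finite_separated_net {X : Type*} [MetricSpace X] [CompactSpace X] (G : Set X)
    {δ : ℝ} (hδ : 0 < δ) :
    ∃ J ⊆ G, J.Finite ∧ (∀ x ∈ J, ∀ y ∈ J, x ≠ y → δ < dist x y) ∧
      ∀ x ∈ G, ∃ y ∈ J, dist x y ≤ δ := by
  lift δ to NNReal using hδ.le
  have hδ0 : δ / 2 ≠ 0 := by
    have : (0 : NNReal) < δ := by exact_mod_cast hδ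
    positivity
  have hpack : Metric.packingNumber δ G ≠ ⊤ := by
    obtain ⟨N, -, hNf, hN⟩ := Metric.exists_finite_isCover_of_totallyBounded (s := G) hδ0
      (isCompact_univ.totallyBounded.subset (subset_univ G))
    have h := Metric.packingNumber_two_mul_le_externalCoveringNumber (δ / 2) G
    rw [mul_div_cancel₀ _ two_ne_zero] at h
    exact ne_top_of_le_ne_top (encard_ne_top_iff.2 hNf)
      (h.trans hN.externalCoveringNumber_le_encard)
  refine ⟨Metric.maximalSeparatedSet δ G, Metric.maximalSeparatedSet_subset, ?_, ?_, ?_⟩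
  · rw [← encard_ne_top_iff, Metric.encard_maximalSeparatedSet hpack]
    exact hpack
  · intro x hx y hy hxy
    have := Metric.isSeparated_maximalSeparatedSet (ε := δ) (A := G) hx hy hxy
    change _ < edist x y at this
    rw [edist_nndist] at this
    exact_mod_cast this
  · intro x hx
    obtain ⟨y, hy, hxy⟩ := Metric.isCover_maximalSeparatedSet hpack hx
    refine ⟨y, hy, ?_⟩
    have h : edist x y ≤ δ := hxy
    rw [edist_nndist] at h
    exact_mod_cast h

/-- A finite family of small closed neighbourhoods `N i` of the points `i ∈ I`, compatible with
the stratification of `X` by the fibres of `t`. -/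
structure IsStratifiedFamily {X P : Type*} [MetricSpace X] [PartialOrder P] (t : X → P) (ε : ℝ)
    (I : Set X) (N : X → Set X) : Prop where
  finite : I.Finite
  mem : ∀ i ∈ I, i ∈ N i
  closed : ∀ i ∈ I, IsClosed (N i)
  subset_ball : ∀ i ∈ I, N i ⊆ Metric.ball i ε
  le : ∀ i ∈ I, ∀ x ∈ N i, t x ≤ t i
  comparable : ∀ i ∈ I, ∀ j ∈ I, (N i ∩ N j).Nonempty → t i ≤ t j ∨ t j ≤ t i
  notMem : ∀ i ∈ I, ∀ j ∈ I, j ≠ i → j ∉ N i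
  lt_of_isolated : ∀ i ∈ I, ¬ AccPt i (𝓟 {x | t x = t i}) →
    ∀ j ∈ I, j ≠ i → (N i ∩ N j).Nonempty → t j < t i

namespace IsStratifiedFamily

variable {X P : Type*} [MetricSpace X] [PartialOrder P] {t : X → P} {ε : ℝ} {I : Set X}
  {N : X → Set X}

theorem isOpen_setOf_le [Finite P] (ht : ∀ p, IsClosed {x | p ≤ t x}) (q : P) :
    IsOpen {x | t x ≤ q} := by
  have h : {x | t x ≤ q}ᶜ = ⋃ p ∈ {p | ¬ p ≤ q}, {x | p ≤ t x} := by
    ext x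
    simp only [mem_compl_iff, mem_ofPred_eq, mem_iUnion, exists_prop]
    exact ⟨fun h => ⟨t x, h, le_rfl⟩, fun ⟨p, hp, hpx⟩ h => hp (hpx.trans h)⟩
  rw [← isClosed_compl_iff, h]
  exact (toFinite _).isClosed_biUnion fun p _ => ht p

theorem exists_swelling [CompactSpace X] [Finite P] (ht : ∀ p, IsClosed {x | p ≤ t x})
    (h : IsStratifiedFamily t ε I N) :
    ∃ M, IsStratifiedFamily t ε I M ∧ ∀ i ∈ I, N i ⊆ interior (M i) := by
  obtain ⟨M, hM⟩ := exists_closed_swelling h.finite N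
    (fun i => Metric.ball i ε ∩ {x | t x ≤ t i} ∩ (I \ {i})ᶜ) h.closed
    (fun i _ => (Metric.isOpen_ball.inter (isOpen_setOf_le ht _)).inter
      (h.finite.subset sdiff_subset).isClosed.isOpen_compl)
    (fun i hi x hx => ⟨⟨h.subset_ball i hi hx, h.le i hi x hx⟩,
      fun hxI => h.notMem i hi x hxI.1 hxI.2 hx⟩)
  refine ⟨M, ⟨h.finite, fun i hi => interior_subset ((hM i hi).2.1 (h.mem i hi)),
    fun i hi => (hM i hi).1, fun i hi x hx => ((hM i hi).2.2.1 hx).1.1,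
    fun i hi x hx => ((hM i hi).2.2.1 hx).1.2, fun i hi j hj hij =>
      h.comparable i hi j hj ((hM i hi).2.2.2 j hj hij),
    fun i hi j hj hij hjM => ((hM i hi).2.2.1 hjM).2 ⟨hj, hij⟩, fun i hi hacc j hj hij hne =>
      h.lt_of_isolated i hi hacc j hj hij ((hM i hi).2.2.2 j hj hne)⟩,
    fun i hi => (hM i hi).2.1⟩

theorem exists_extension (h : IsStratifiedFamily t ε I N) {J : Set X} {F : X → Set X} {τ : P}
    (hJ : J.Finite) (hFτ : ∀ y ∈ J, ∀ x ∈ F y, t x = τ) (hmem : ∀ y ∈ J, y ∈ F y)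
    (hcl : ∀ y ∈ J, IsClosed (F y)) (hball : ∀ y ∈ J, F y ⊆ Metric.ball y ε)
    (hN : ∀ i ∈ I, ∀ y ∈ J, y ∉ N i) (hF : ∀ i ∈ I, ∀ y ∈ J, i ∉ F y)
    (hFF : ∀ y ∈ J, ∀ z ∈ J, z ≠ y → z ∉ F y)
    (hne : ∀ i ∈ I, ∀ y ∈ J, (N i ∩ F y).Nonempty → t i ≠ τ)
    (hiso : ∀ y ∈ J, ¬ AccPt y (𝓟 {x | t x = τ}) → (∀ i ∈ I, ¬ (N i ∩ F y).Nonempty) ∧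
      ∀ z ∈ J, z ≠ y → ¬ (F y ∩ F z).Nonempty) :
    ∃ M, IsStratifiedFamily t ε (I ∪ J) M ∧ (∀ i ∈ I, M i = N i) ∧ ∀ y ∈ J, M y = F y := by
  classical
  have hIJ : ∀ i ∈ I, i ∉ J := fun i hi hiJ => hN i hi i hiJ (h.mem i hi)
  have hτ : ∀ y ∈ J, t y = τ := fun y hy => hFτ y hy y (hmem y hy)
  have hlt : ∀ i ∈ I, ∀ y ∈ J, (N i ∩ F y).Nonempty → τ < t i := by
    rintro i hi y hy ⟨x, hxi, hxy⟩
    exact lt_of_le_of_ne (hFτ y hy x hxy ▸ h.le i hi x hxi) (hne i hi y hy ⟨x, hxi, hxy⟩).symm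
  obtain ⟨M, hMI, hMJ⟩ : ∃ M : X → Set X, (∀ i ∈ I, M i = N i) ∧ ∀ y ∈ J, M y = F y :=
    ⟨J.piecewise F N, fun i hi => piecewise_eq_of_notMem _ _ _ (hIJ i hi),
      fun y hy => piecewise_eq_of_mem _ _ _ hy⟩
  refine ⟨M, ⟨h.finite.union hJ, ?_, ?_, ?_, ?_, ?_, ?_, ?_⟩, hMI, hMJ⟩
  · rintro i (hi | hi)
    · rw [hMI i hi]; exact h.mem i hi
    · rw [hMJ i hi]; exact hmem i hi
  · rintro i (hi | hi)
    · rw [hMI i hi]; exact h.closed i hi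
    · rw [hMJ i hi]; exact hcl i hi
  · rintro i (hi | hi)
    · rw [hMI i hi]; exact h.subset_ball i hi
    · rw [hMJ i hi]; exact hball i hi
  · rintro i (hi | hi)
    · rw [hMI i hi]; exact h.le i hi
    · rw [hMJ i hi]
      intro x hx
      rw [hFτ i hi x hx, hτ i hi]
  · rintro i (hi | hi) j (hj | hj)
    · rw [hMI i hi, hMI j hj]; exact h.comparable i hi j hj
    · rw [hMI i hi, hMJ j hj, hτ j hj]; exact fun hij => Or.inr (hlt i hi j hj hij).le
    · rw [hMJ i hi, hMI j hj, hτ i hi, inter_comm]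
      exact fun hij => Or.inl (hlt j hj i hi hij).le
    · rw [hτ i hi, hτ j hj]; exact fun _ => Or.inl le_rfl
  · rintro i (hi | hi) j (hj | hj)
    · rw [hMI i hi]; exact h.notMem i hi j hj
    · rw [hMI i hi]; exact fun _ => hN i hi j hj
    · rw [hMJ i hi]; exact fun _ => hF j hj i hi
    · rw [hMJ i hi]; exact hFF i hi j hj
  · rintro i (hi | hi) hacc j (hj | hj)
    · rw [hMI i hi, hMI j hj]; exact h.lt_of_isolated i hi hacc j hj
    · rw [hMI i hi, hMJ j hj, hτ j hj]; exact fun _ => hlt i hi j hj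
    · rw [hτ i hi] at hacc
      rw [hMJ i hi, hMI j hj, inter_comm]
      exact fun _ hij => absurd hij ((hiso i hi hacc).1 j hj)
    · rw [hτ i hi] at hacc
      rw [hMJ i hi, hMJ j hj]
      exact fun hne' hij => absurd hij ((hiso i hi hacc).2 j hj hne')

theorem exists_cover_insert [CompactSpace X] [Finite P] (hε : 0 < ε)
    (ht : ∀ p, IsClosed {x | p ≤ t x}) {τ : P} {Q : Set P} (hτQ : τ ∉ Q)
    (hQ : ∀ p, τ < p → p ∈ Q) (h : IsStratifiedFamily t ε I N) (hI : ∀ i ∈ I, t i ∈ Q)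
    (hcov : ∀ x, t x ∈ Q → ∃ i ∈ I, x ∈ N i) :
    ∃ I' N', IsStratifiedFamily t ε I' N' ∧ (∀ i ∈ I', t i ∈ insert τ Q) ∧
      ∀ x, t x ∈ insert τ Q → ∃ i ∈ I', x ∈ N' i := by
  obtain ⟨N₁, h₁, hN₁⟩ := h.exists_swelling ht
  have hcompact : ∀ (A : Set X) (M : X → Set X),
      IsClosed ({x | τ ≤ t x} \ ⋃ i ∈ A, interior (M i)) := fun A M =>
    (ht τ).sdiff (isOpen_biUnion fun _ _ => isOpen_interior)
  set H := {x | τ ≤ t x} \ ⋃ i ∈ I, interior (N₁ i) with hH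
  have hHτ : ∀ x ∈ H, t x = τ := by
    rintro x ⟨hx, hxN⟩
    by_contra hne
    obtain ⟨i, hi, hxi⟩ := hcov x (hQ _ (lt_of_le_of_ne hx (Ne.symm hne)))
    exact hxN (mem_iUnion₂.2 ⟨i, hi, hN₁ i hi hxi⟩)
  have hIτ : ∀ i ∈ I, t i ≠ τ := fun i hi hit => hτQ (hit ▸ hI i hi)
  set G := {x | t x = τ ∧ AccPt x (𝓟 {x | t x = τ}) ∧ ∀ i ∈ I, x ∉ N₁ i} with hG
  have hGH : G ⊆ H := fun x hx => ⟨hx.1.ge, fun hxN => by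
    obtain ⟨i, hi, hxi⟩ := mem_iUnion₂.1 hxN
    exact hx.2.2 i hi (interior_subset hxi)⟩
  obtain ⟨J, hJG, hJ, hsep, hnet⟩ := exists_finite_separated_net G (half_pos hε)
  obtain ⟨N₂, h₂, hN₂I, hN₂J⟩ := h₁.exists_extension (F := fun y => Metric.closedBall y (ε / 2) ∩ H)
    (τ := τ) hJ (fun y _ x hx => hHτ x hx.2)
    (fun y hy => ⟨Metric.mem_closedBall_self (half_pos hε).le, hGH (hJG hy)⟩)
    (fun y _ => Metric.isClosed_closedBall.inter (hcompact _ _))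
    (fun y _ => inter_subset_left.trans (Metric.closedBall_subset_ball (half_lt_self hε)))
    (fun i hi y hy => (hJG hy).2.2 i hi) (fun i hi y _ hiF => hIτ i hi (hHτ i hiF.2))
    (fun y hy z hz hzy hzF => (hsep z hz y hy hzy).not_ge hzF.1) (fun i hi _ _ _ => hIτ i hi)
    (fun y hy hacc => absurd (hJG hy).2.1 hacc)
  have hacc₂ : ∀ x, t x = τ → AccPt x (𝓟 {x | t x = τ}) → ∃ i ∈ I ∪ J, x ∈ N₂ i := by
    intro x hx hacc
    by_cases hxI : ∃ i ∈ I, x ∈ N₁ i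
    · obtain ⟨i, hi, hxi⟩ := hxI
      exact ⟨i, Or.inl hi, by rwa [hN₂I i hi]⟩
    · have hxG : x ∈ G := ⟨hx, hacc, fun i hi hxi => hxI ⟨i, hi, hxi⟩⟩
      obtain ⟨y, hy, hxy⟩ := hnet x hxG
      exact ⟨y, Or.inr hy, by rw [hN₂J y hy]; exact ⟨hxy, hGH hxG⟩⟩
  have hcov₂ : ∀ x, t x ∈ Q → ∃ i ∈ I ∪ J, x ∈ N₂ i := fun x hx => by
    obtain ⟨i, hi, hxi⟩ := hcov x hx
    exact ⟨i, Or.inl hi, by rw [hN₂I i hi]; exact interior_subset (hN₁ i hi hxi)⟩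
  obtain ⟨N₃, h₃, hN₃⟩ := h₂.exists_swelling ht
  set E := {x | t x = τ ∧ ∀ i ∈ I ∪ J, x ∉ N₃ i} with hE
  have hEacc : ∀ x ∈ E, ¬ AccPt x (𝓟 {x | t x = τ}) := fun x hx hacc => by
    obtain ⟨i, hi, hxi⟩ := hacc₂ x hx.1 hacc
    exact hx.2 i hi (interior_subset (hN₃ i hi hxi))
  have hEfin : E.Finite := by
    by_contra hinf
    obtain ⟨x, hx⟩ := Set.Infinite.exists_accPt_principal hinf
    have hEcl : E ⊆ {x | τ ≤ t x} \ ⋃ i ∈ I ∪ J, interior (N₃ i) := fun y hy =>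
      ⟨hy.1.ge, fun hyN => by
        obtain ⟨i, hi, hyi⟩ := mem_iUnion₂.1 hyN
        exact hy.2 i hi (interior_subset hyi)⟩
    have hxcl := (hcompact (I ∪ J) N₃).closure_subset_iff.2 hEcl
      (mem_closure_iff_clusterPt.2 hx.clusterPt)
    have hxN : ∀ i ∈ I ∪ J, x ∉ N₂ i := fun i hi hxi =>
      hxcl.2 (mem_iUnion₂.2 ⟨i, hi, hN₃ i hi hxi⟩)
    have hxτ : t x = τ := by
      by_contra hne
      obtain ⟨i, hi, hxi⟩ := hcov₂ x (hQ _ (lt_of_le_of_ne hxcl.1 (Ne.symm hne)))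
      exact hxN i hi hxi
    obtain ⟨i, hi, hxi⟩ := hacc₂ x hxτ (hx.mono (principal_mono.2 fun y hy => hy.1))
    exact hxN i hi hxi
  obtain ⟨N₄, h₄, hN₄I, hN₄E⟩ := h₃.exists_extension (F := fun y => {y}) (τ := τ) hEfin
    (fun y hy x hx => by rw [mem_singleton_iff.1 hx]; exact hy.1) (fun y _ => rfl)
    (fun y _ => isClosed_singleton) (fun y _ => by simpa using hε)
    (fun i hi y hy => hy.2 i hi)
    (fun i hi y hy hiy => hy.2 i hi (mem_singleton_iff.1 hiy ▸ h₃.mem i hi))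
    (fun y _ z _ hzy hz => hzy hz)
    (fun i hi y hy ⟨x, hxi, hxy⟩ => absurd (mem_singleton_iff.1 hxy ▸ hxi) (hy.2 i hi))
    (fun y hy _ => ⟨fun i hi ⟨x, hxi, hxy⟩ => hy.2 i hi (mem_singleton_iff.1 hxy ▸ hxi),
      fun z _ hzy ⟨x, hxy, hxz⟩ => hzy (hxz.symm.trans hxy)⟩)
  refine ⟨_, N₄, h₄, ?_, ?_⟩
  · rintro i ((hi | hi) | hi)
    · exact Or.inr (hI i hi)
    · exact Or.inl (hJG hi).1
    · exact Or.inl hi.1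
  · intro x hx
    by_cases hxI : ∃ i ∈ I ∪ J, x ∈ N₃ i
    · obtain ⟨i, hi, hxi⟩ := hxI
      exact ⟨i, Or.inl hi, by rwa [hN₄I i hi]⟩
    · rcases hx with hx | hx
      · have hxE : x ∈ E := ⟨hx, fun i hi hxi => hxI ⟨i, hi, hxi⟩⟩
        exact ⟨x, Or.inr hxE, by rw [hN₄E x hxE]; rfl⟩
      · obtain ⟨i, hi, hxi⟩ := hcov₂ x hx
        exact absurd ⟨i, hi, interior_subset (hN₃ i hi hxi)⟩ hxI

theorem exists_cover [CompactSpace X] [Finite P] (hε : 0 < ε)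
    (ht : ∀ p, IsClosed {x | p ≤ t x}) :
    ∃ I N, IsStratifiedFamily t ε I N ∧ ∀ x, ∃ i ∈ I, x ∈ N i := by
  suffices H : ∀ n : ℕ, ∀ Q : Set P, IsUpperSet Q → Q.ncard = n →
      ∃ I N, IsStratifiedFamily t ε I N ∧ (∀ i ∈ I, t i ∈ Q) ∧
        ∀ x, t x ∈ Q → ∃ i ∈ I, x ∈ N i by
    obtain ⟨I, N, h, -, hcov⟩ := H _ univ isUpperSet_univ rfl
    exact ⟨I, N, h, fun x => hcov x (mem_univ _)⟩
  intro n
  induction n with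
  | zero =>
    intro Q _ hQ
    rw [Set.ncard_eq_zero] at hQ
    subst hQ
    exact ⟨∅, fun _ => ∅, ⟨finite_empty, by simp, by simp, by simp, by simp, by simp, by simp,
      by simp⟩, by simp, by simp⟩
  | succ n ih =>
    intro Q hQ hn
    have hne : Q.Nonempty := by
      rw [← Set.ncard_pos, hn]
      exact n.succ_pos
    obtain ⟨τ, hτ⟩ := (toFinite Q).exists_minimal hne
    obtain ⟨I, N, h, hI, hcov⟩ := ih (Q \ {τ})
      (fun a b hab ha => ⟨hQ hab ha.1, fun hb => ha.2
        (le_antisymm (hab.trans (mem_singleton_iff.1 hb).le)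
          (hτ.2 ha.1 (hab.trans (mem_singleton_iff.1 hb).le)))⟩)
      (by rw [Set.ncard_sdiff_singleton_of_mem hτ.1, hn]; rfl)
    have := exists_cover_insert hε ht (τ := τ) (Q := Q \ {τ}) (fun h => h.2 rfl)
      (fun p hp => ⟨hQ hp.le hτ.1, hp.ne'⟩) h hI hcov
    rwa [insert_sdiff_singleton, insert_eq_of_mem hτ.1] at this

end IsStratifiedFamily

/-- A finite binary family of closed sets can be enlarged by a finite cover consisting of small
closed sets so that it remains binary. -/
theorem IsBinary.exists_union_small_cover {X : Type*} [MetricSpace X] [CompactSpace X]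
    {𝒜 : Set (Set X)} (hfin : 𝒜.Finite) (hcl : ∀ A ∈ 𝒜, IsClosed A) (hb : IsBinary 𝒜)
    {ε : ℝ} (hε : 0 < ε) :
    ∃ ℬ : Set (Set X), ℬ.Finite ∧ (∀ B ∈ ℬ, IsClosed B) ∧ IsBinary (𝒜 ∪ ℬ) ∧ ⋃₀ ℬ = univ ∧
      ∀ B ∈ ℬ, ∀ x ∈ B, ∀ y ∈ B, dist x y ≤ ε := by
  classical
  rcases isEmpty_or_nonempty X with hX | hX
  · exact ⟨∅, finite_empty, by simp, by simpa using hb, Subsingleton.elim _ _, by simp⟩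
  have := hfin.to_subtype
  let t : X → Set 𝒜 := fun x => {A | x ∈ A.1}
  have ht : ∀ p : Set 𝒜, IsClosed {x | p ≤ t x} := fun p => by
    have h : {x | p ≤ t x} = ⋂ A ∈ p, A.1 := by
      ext x
      simp only [mem_iInter]
      rfl
    rw [h]
    exact isClosed_biInter fun A _ => hcl A A.2
  have hε6 : 0 < ε / 6 := by positivity
  obtain ⟨I, N, h, hcov⟩ := IsStratifiedFamily.exists_cover hε6 ht
  let 𝒬 : Set (Set X) := {β | β ⊆ I ∧ β.Nontrivial ∧ ∀ i ∈ β, ∀ j ∈ β, (N i ∩ N j).Nonempty}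
  have h𝒬 : 𝒬.Finite := h.finite.finite_subsets.subset fun β hβ => hβ.1
  have hmin : ∀ β ∈ 𝒬, ∃ i ∈ β, ∀ j ∈ β, t i ≤ t j := by
    intro β hβ
    obtain ⟨i, hi⟩ := (h.finite.subset hβ.1).exists_minimalFor t β hβ.2.1.nonempty
    refine ⟨i, hi.1, fun j hj => ?_⟩
    rcases h.comparable i (hβ.1 hi.1) j (hβ.1 hj) (hβ.2.2 i hi.1 j hj) with hij | hij
    · exact hij
    · exact hi.2 hj hij
  choose! m hmβ hm using hmin
  let U : X → Set X := fun i => {x | t x = t i ∧ x ∈ N i ∧ ∀ j ∈ I, j ≠ i → x ∉ N j}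
  have hU : ∀ β ∈ 𝒬, (U (m β)).Infinite := by
    intro β hβ
    have hi := hβ.1 (hmβ β hβ)
    have hacc : AccPt (m β) (𝓟 {x | t x = t (m β)}) := by
      by_contra hacc
      obtain ⟨j, hj, hji⟩ := hβ.2.1.exists_ne (m β)
      exact (h.lt_of_isolated _ hi hacc j (hβ.1 hj) hji
        (hβ.2.2 _ (hmβ β hβ) j hj)).not_ge (hm β hβ j hj)
    have hW : IsOpen (⋃ j ∈ I \ {m β}, N j)ᶜ :=
      ((h.finite.subset sdiff_subset).isClosed_biUnion fun j hj => h.closed j hj.1).isOpen_compl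
    have hmW : m β ∈ (⋃ j ∈ I \ {m β}, N j)ᶜ := by
      simp only [mem_compl_iff, mem_iUnion, not_exists]
      exact fun j hj hmj => h.notMem j hj.1 _ hi (Ne.symm hj.2) hmj
    refine Set.Infinite.mono ?_ (Set.Infinite.of_accPt (hacc.nhds_inter (hW.mem_nhds hmW)))
    rintro x ⟨hxW, hxt⟩
    have hx : ∀ j ∈ I, j ≠ m β → x ∉ N j := fun j hj hjm hxj =>
      hxW (mem_iUnion₂.2 ⟨j, ⟨hj, hjm⟩, hxj⟩)
    refine ⟨hxt, ?_, hx⟩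
    obtain ⟨i, hiI, hxi⟩ := hcov x
    by_cases him : i = m β
    · rwa [← him]
    · exact absurd hxi (hx i hiI him)
  obtain ⟨e, he⟩ := countable_iff_exists_injOn.1 h𝒬.countable
  have hp : ∃ p : Set X → X, (∀ β ∈ 𝒬, p β ∈ U (m β)) ∧ InjOn p 𝒬 := by
    have hf : ∀ i, ∃ f : ℕ → X, (U i).Infinite → f.Injective ∧ ∀ n, f n ∈ U i := by
      intro i
      by_cases hi : (U i).Infinite
      · exact ⟨fun n => hi.natEmbedding _ n, fun _ =>
          ⟨Subtype.val_injective.comp (hi.natEmbedding _).injective, fun n => Subtype.coe_prop _⟩⟩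
      · exact ⟨fun _ => i, fun h => absurd h hi⟩
    choose f hf using hf
    refine ⟨fun β => f (m β) (e β), fun β hβ => (hf _ (hU β hβ)).2 _, fun β hβ γ hγ hβγ => ?_⟩
    have h1 := (hf _ (hU β hβ)).2 (e β)
    have h2 := (hf _ (hU γ hγ)).2 (e γ)
    simp only at hβγ
    have hmm : m β = m γ := by
      by_contra hne
      rw [hβγ] at h1
      exact h2.2.2 _ (hβ.1 (hmβ β hβ)) hne h1.2.1
    rw [hmm] at hβγ
    exact he hβ hγ ((hf _ (hU γ hγ)).1 hβγ)
  obtain ⟨p, hpU, hpinj⟩ := hp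
  let M : X → Set X := fun i => N i ∪ p '' {β ∈ 𝒬 | i ∈ β}
  have hMcl : ∀ i ∈ I, IsClosed (M i) := fun i hi =>
    (h.closed i hi).union ((h𝒬.subset (sep_subset _ _)).image p).isClosed
  have hMA : ∀ i ∈ I, ∀ A ∈ 𝒜, (M i ∩ A).Nonempty → i ∈ A := by
    rintro i hi A hA ⟨x, hx | ⟨β, ⟨hβ, hiβ⟩, rfl⟩, hxA⟩
    · exact h.le i hi x hx (show (⟨A, hA⟩ : 𝒜) ∈ t x from hxA)
    · have h1 : (⟨A, hA⟩ : 𝒜) ∈ t (p β) := hxA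
      rw [(hpU β hβ).1] at h1
      exact hm β hβ i hiβ h1
  have hpriv : ∀ β ∈ 𝒬, ∀ i ∈ I, p β ∈ N i → i ∈ β := fun β hβ i hi hpi => by
    by_cases him : i = m β
    · rw [him]; exact hmβ β hβ
    · exact absurd hpi ((hpU β hβ).2.2 i hi him)
  have hMM : ∀ i ∈ I, ∀ j ∈ I, (M i ∩ M j).Nonempty → (N i ∩ N j).Nonempty := by
    rintro i hi j hj ⟨x, hx | ⟨β, ⟨hβ, hiβ⟩, rfl⟩, hx' | ⟨γ, ⟨hγ, hjγ⟩, hγx⟩⟩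
    · exact ⟨x, hx, hx'⟩
    · subst hγx
      exact hγ.2.2 i (hpriv γ hγ i hi hx) j hjγ
    · exact hβ.2.2 i hiβ j (hpriv β hβ j hj hx')
    · rw [hpinj hγ hβ hγx] at hjγ
      exact hβ.2.2 i hiβ j hjγ
  refine ⟨M '' I, h.finite.image M, ?_, ?_, ?_, ?_⟩
  · rintro _ ⟨i, hi, rfl⟩
    exact hMcl i hi
  · intro L hL hLne hlink
    set β := {i ∈ I | M i ∈ L} with hβ
    have hLβ : ∀ A ∈ L, A ∉ 𝒜 → ∃ i ∈ β, M i = A := fun A hA hA𝒜 => by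
      obtain ⟨i, hi, rfl⟩ := (hL hA).resolve_left hA𝒜
      exact ⟨i, ⟨hi, hA⟩, rfl⟩
    rcases β.eq_empty_or_nonempty with hβe | ⟨i, hi⟩
    · refine hb L (fun A hA => ?_) hLne hlink
      by_contra hA𝒜
      obtain ⟨i, hi, -⟩ := hLβ A hA hA𝒜
      rw [hβe] at hi
      exact hi
    · by_cases hnt : β.Nontrivial
      · have hβ𝒬 : β ∈ 𝒬 := ⟨sep_subset _ _, hnt, fun i hi j hj =>
          hMM i hi.1 j hj.1 (hlink _ hi.2 _ hj.2)⟩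
        refine ⟨p β, fun A hA => ?_⟩
        by_cases hA𝒜 : A ∈ 𝒜
        · have hmA := hMA (m β) (hβ𝒬.1 (hmβ β hβ𝒬)) A hA𝒜 (hlink _ (hmβ β hβ𝒬).2 A hA)
          have h1 : (⟨A, hA𝒜⟩ : 𝒜) ∈ t (m β) := hmA
          rw [← (hpU β hβ𝒬).1] at h1
          exact h1
        · obtain ⟨j, hj, rfl⟩ := hLβ A hA hA𝒜
          exact Or.inr ⟨β, ⟨hβ𝒬, hj⟩, rfl⟩
      · refine ⟨i, fun A hA => ?_⟩
        by_cases hA𝒜 : A ∈ 𝒜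
        · exact hMA i hi.1 A hA𝒜 (hlink _ hi.2 A hA)
        · obtain ⟨j, hj, rfl⟩ := hLβ A hA hA𝒜
          rw [not_nontrivial_iff.1 hnt hj hi]
          exact Or.inl (h.mem i hi.1)
  · refine eq_univ_of_forall fun x => ?_
    obtain ⟨i, hi, hx⟩ := hcov x
    exact ⟨M i, mem_image_of_mem _ hi, Or.inl hx⟩
  · have hMi : ∀ i ∈ I, ∀ x ∈ M i, dist x i ≤ ε / 2 := by
      rintro i hi x (hx | ⟨β, ⟨hβ, hiβ⟩, rfl⟩)
      · have := Metric.mem_ball.1 (h.subset_ball i hi hx)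
        linarith
      · have hmI := hβ.1 (hmβ β hβ)
        obtain ⟨z, hz1, hz2⟩ := hβ.2.2 _ (hmβ β hβ) i hiβ
        have h1 := Metric.mem_ball.1 (h.subset_ball _ hmI (hpU β hβ).2.1)
        have h2 := Metric.mem_ball.1 (h.subset_ball _ hmI hz1)
        have h3 := Metric.mem_ball.1 (h.subset_ball i hi hz2)
        have h4 := dist_triangle4 (p β) (m β) z i
        rw [dist_comm (m β) z] at h4
        linarith
    rintro _ ⟨i, hi, rfl⟩ x hx y hy
    have := dist_triangle_right x y i
    linarith [hMi i hi x hx, hMi i hi y hy]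

/-- A compact metric space has a binary family of small closed sets that contains finite covers
by arbitrarily small sets. -/
theorem exists_isBinary_small_covers (X : Type*) [MetricSpace X] [CompactSpace X]
    {ε : ℝ} (hε : 0 < ε) :
    ∃ ℱ : Set (Set X), (∀ F ∈ ℱ, IsClosed F) ∧ IsBinary ℱ ∧
      (∀ F ∈ ℱ, ∀ x ∈ F, ∀ y ∈ F, dist x y ≤ ε) ∧
      ∀ η > 0, ∃ ℬ ⊆ ℱ, ℬ.Finite ∧ ⋃₀ ℬ = univ ∧ ∀ B ∈ ℬ, ∀ x ∈ B, ∀ y ∈ B, dist x y ≤ η := by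
  let σ := {𝒜 : Set (Set X) // 𝒜.Finite ∧ (∀ A ∈ 𝒜, IsClosed A) ∧ IsBinary 𝒜}
  have hstep : ∀ (n : ℕ) (𝒜 : σ), ∃ 𝒞 : σ, 𝒜.1 ⊆ 𝒞.1 ∧ ∃ ℬ ⊆ 𝒞.1, 𝒞.1 ⊆ 𝒜.1 ∪ ℬ ∧
      ⋃₀ ℬ = univ ∧ ∀ B ∈ ℬ, ∀ x ∈ B, ∀ y ∈ B, dist x y ≤ ε / (n + 1) := by
    rintro n ⟨𝒜, hfin, hcl, hb⟩
    obtain ⟨ℬ, h1, h2, h3, h4, h5⟩ := hb.exists_union_small_cover hfin hcl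
      (ε := ε / (n + 1)) (by positivity)
    exact ⟨⟨𝒜 ∪ ℬ, hfin.union h1, fun A hA => hA.elim (hcl A) (h2 A), h3⟩, subset_union_left,
      ℬ, subset_union_right, Subset.rfl, h4, h5⟩
  choose s hs𝒜 b hbs hsb hcov hdist using hstep
  let 𝒜 : ℕ → σ := fun n => Nat.rec ⟨∅, finite_empty, by simp, fun L hL hne =>
    absurd (subset_empty_iff.1 hL) hne.ne_empty⟩ (fun n 𝒜 => s n 𝒜) n
  have h𝒜mono : Monotone fun n => (𝒜 n).1 := monotone_nat_of_le_succ fun n => hs𝒜 n (𝒜 n)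
  have hnew : ∀ k n, ∀ A ∈ (𝒜 k).1, A ∉ (𝒜 n).1 → ∃ l ≥ n, A ∈ b l (𝒜 l) := by
    intro k n A
    induction k with
    | zero => exact fun hA => absurd hA (notMem_empty A)
    | succ k ih =>
      intro hA hAn
      rcases hsb k (𝒜 k) hA with hA' | hA'
      · exact ih hA' hAn
      · refine ⟨k, ?_, hA'⟩
        by_contra hkn
        exact hAn (h𝒜mono (Nat.succ_le_of_lt (not_le.1 hkn)) hA)
  have hsmall : ∀ l n : ℕ, n ≤ l → ε / (l + 1) ≤ ε / (n + 1) := fun l n hnl => by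
    have : (n : ℝ) ≤ l := by exact_mod_cast hnl
    gcongr
  have hlim : ∀ η > 0, ∃ n : ℕ, ε / (n + 1) < η := fun η hη => by
    obtain ⟨n, hn⟩ := exists_nat_gt (ε / η)
    refine ⟨n, ?_⟩
    rw [div_lt_iff₀ hη] at hn
    rw [div_lt_iff₀ (by positivity)]
    nlinarith
  refine ⟨⋃ n, (𝒜 n).1, ?_, ?_, ?_, ?_⟩
  · intro F hF
    obtain ⟨n, hn⟩ := mem_iUnion.1 hF
    exact (𝒜 n).2.2.1 F hn
  · intro L hL hne hlink
    by_cases hLn : ∃ n, L ⊆ (𝒜 n).1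
    · obtain ⟨n, hn⟩ := hLn
      exact (𝒜 n).2.2.2 L hn hne hlink
    have hLsmall : ∀ n : ℕ, ∃ F ∈ L, ∀ x ∈ F, ∀ y ∈ F, dist x y ≤ ε / (n + 1) := by
      intro n
      obtain ⟨F, hF, hFn⟩ := not_subset.1 fun h => hLn ⟨n, h⟩
      obtain ⟨k, hk⟩ := mem_iUnion.1 (hL hF)
      obtain ⟨l, hl, hFl⟩ := hnew k n F hk hFn
      exact ⟨F, hF, fun x hx y hy => (hdist l (𝒜 l) F hFl x hx y hy).trans (hsmall l n hl)⟩
    choose F hFL hF using hLsmall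
    choose x hx using fun n => hlink _ (hFL n) _ (hFL n)
    obtain ⟨a, -, φ, hφ, hlima⟩ := isCompact_univ.tendsto_subseq fun n => mem_univ (x n)
    refine ⟨a, fun A hA => ?_⟩
    obtain ⟨k, hk⟩ := mem_iUnion.1 (hL hA)
    rw [← ((𝒜 k).2.2.1 A hk).closure_eq, Metric.mem_closure_iff]
    intro η hη
    obtain ⟨n, hn⟩ := hlim (η / 2) (half_pos hη)
    obtain ⟨K, hK⟩ := Metric.tendsto_atTop.1 hlima (η / 2) (half_pos hη)
    have h1 := hK (max K n) (le_max_left _ _)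
    obtain ⟨y, hyF, hyA⟩ := hlink _ (hFL (φ (max K n))) A hA
    have h2 := hF (φ (max K n)) _ (hx _).1 y hyF
    have h3 := hsmall (φ (max K n)) n ((le_max_right _ _).trans (hφ.le_apply))
    refine ⟨y, hyA, ?_⟩
    have h4 := dist_triangle_left a y (x (φ (max K n)))
    simp only [Function.comp] at h1
    linarith
  · intro F hF
    obtain ⟨n, hn⟩ := mem_iUnion.1 hF
    obtain ⟨l, -, hl⟩ := hnew n 0 F hn (notMem_empty F)
    intro x hx y hy
    have := hdist l _ F hl x hx y hy
    have := hsmall l 0 l.zero_le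
    simp only [Nat.cast_zero, zero_add, div_one] at this
    linarith
  · intro η hη
    obtain ⟨n, hn⟩ := hlim η hη
    have hsub : b n (𝒜 n) ⊆ (𝒜 (n + 1)).1 := hbs n (𝒜 n)
    exact ⟨b n (𝒜 n), hsub.trans (subset_iUnion (fun n => (𝒜 n).1) (n + 1)),
      (𝒜 (n + 1)).2.1.subset hsub, hcov n _,
      fun B hB x hx y hy => (hdist n _ B hB x hx y hy).trans hn.le⟩

section Collar

variable {K : Type*} [MetricSpace K]

/-- A decreasing sequence of closed neighbourhoods of `C`. -/
def collar (C : Set K) (n : ℕ) : Set K := Metric.cthickening (1 / (n + 1)) C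

/-- `V` is a union of chain components of `collar C n` for chains of mesh less than
`2 / (n + 1)`. -/
def IsChainSaturated (C : Set K) (n : ℕ) (V : Set K) : Prop :=
  ∀ u ∈ collar C n, ∀ w ∈ collar C n, dist u w < 2 / (n + 1) → (u ∈ V ↔ w ∈ V)

/-- The chain component of `x` in `collar C n`, for chains of mesh less than `2 / (n + 1)`. -/
def cell (C : Set K) (n : ℕ) (x : K) : Set K :=
  {y | y ∈ collar C n ∧ ∀ V, IsChainSaturated C n V → (x ∈ V ↔ y ∈ V)}

/-- The traces on `Y` of the cells of those collars which contain `Y`. -/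
def cellTraces (C Y : Set K) : Set (Set K) :=
  {A | ∃ n, Y ⊆ collar C n ∧ ∃ c ∈ C, A = cell C n c ∩ Y}

/-- Distinct points of `C` lie in different parts of a partition of `C` into two closed sets. -/
def SeparatedByClopens (C : Set K) : Prop :=
  ∀ x ∈ C, ∀ y ∈ C, x ≠ y →
    ∃ P Q : Set K, IsClosed P ∧ IsClosed Q ∧ Disjoint P Q ∧ C = P ∪ Q ∧ x ∈ P ∧ y ∈ Q

variable {C Y : Set K} {m n : ℕ} {x y c c' : K}

theorem subset_collar (C : Set K) (n : ℕ) : C ⊆ collar C n :=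
  Metric.self_subset_cthickening C

theorem isClosed_collar (C : Set K) (n : ℕ) : IsClosed (collar C n) := Metric.isClosed_cthickening

theorem collar_anti (C : Set K) (h : n ≤ m) : collar C m ⊆ collar C n :=
  Metric.cthickening_mono (one_div_le_one_div_of_le (by positivity) (by gcongr)) C

theorem exists_dist_lt_of_mem_collar (hx : x ∈ collar C n) :
    ∃ c ∈ C, dist x c < 2 / (n + 1) := by
  have h : (0 : ℝ) < n + 1 := by positivity
  exact Metric.mem_thickening_iff.1 (Metric.cthickening_subset_thickening'
    (by positivity) (div_lt_div_of_pos_right one_lt_two h) C hx)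

theorem exists_notMem_collar [CompactSpace K] (hC : IsClosed C) (hx : x ∉ C) :
    ∃ n, x ∉ collar C n := by
  obtain ⟨δ, hδ, h⟩ := hC.isCompact.exists_cthickening_subset_open
    (isOpen_compl_singleton (x := x)) fun y hy hyx => hx (mem_singleton_iff.1 hyx ▸ hy)
  obtain ⟨n, hn⟩ := exists_nat_one_div_lt hδ
  exact ⟨n, fun hxn => h (Metric.cthickening_mono hn.le C hxn) rfl⟩

theorem IsChainSaturated.mono {V : Set K} (hV : IsChainSaturated C n V) (h : n ≤ m) :
    IsChainSaturated C m V := fun u hu w hw huw =>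
  hV u (collar_anti C h hu) w (collar_anti C h hw) (huw.trans_le
    (div_le_div_of_nonneg_left zero_le_two (by positivity) (by gcongr)))

theorem mem_cell_of_dist_lt (hx : x ∈ cell C n c) (hy : y ∈ collar C n)
    (hxy : dist x y < 2 / (n + 1)) : y ∈ cell C n c :=
  ⟨hy, fun V hV => (hx.2 V hV).trans (hV x hx.1 y hy hxy)⟩

theorem mem_cell_self (hx : x ∈ collar C n) : x ∈ cell C n x := ⟨hx, fun _ _ => Iff.rfl⟩

theorem isClosed_cell (C : Set K) (n : ℕ) (x : K) : IsClosed (cell C n x) := by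
  refine isClosed_of_closure_subset fun y hy => ?_
  have hyC : y ∈ collar C n := (isClosed_collar C n).closure_subset_iff.2 (fun z hz => hz.1) hy
  obtain ⟨z, hz, hyz⟩ := Metric.mem_closure_iff.1 hy (2 / (n + 1)) (by positivity)
  exact mem_cell_of_dist_lt hz hyC (by rwa [dist_comm])

theorem cell_subset_cell (h : n ≤ m) (hy : y ∈ cell C n c) (hy' : y ∈ cell C m c') :
    cell C m c' ⊆ cell C n c := fun _ hz => ⟨collar_anti C h hz.1, fun V hV =>
  (hy.2 V hV).trans ((hy'.2 V (hV.mono h)).symm.trans (hz.2 V (hV.mono h)))⟩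

theorem cell_subset_or_subset (h : (cell C n c ∩ cell C m c').Nonempty) :
    cell C n c ⊆ cell C m c' ∨ cell C m c' ⊆ cell C n c := by
  obtain ⟨y, hy, hy'⟩ := h
  rcases le_total n m with h | h
  · exact Or.inr (cell_subset_cell h hy hy')
  · exact Or.inl (cell_subset_cell h hy' hy)

theorem exists_finite_cells_cover [CompactSpace K] (C : Set K) (n : ℕ) :
    ∃ s ⊆ C, s.Finite ∧ collar C n ⊆ ⋃ c ∈ s, cell C n c := by
  have hn : (0 : ℝ) < n + 1 := by positivity
  obtain ⟨s, hsC, hs, -, hnet⟩ := exists_finite_separated_net C (δ := 1 / (n + 1)) (by positivity)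
  refine ⟨s, hsC, hs, fun x hx => ?_⟩
  obtain ⟨c, hc, hxc⟩ := exists_dist_lt_of_mem_collar hx
  obtain ⟨y, hy, hcy⟩ := hnet c hc
  have h1 : c ∈ cell C n y := mem_cell_of_dist_lt (mem_cell_self (subset_collar C n (hsC hy)))
    (subset_collar C n hc)
    (by rw [dist_comm]; exact hcy.trans_lt (div_lt_div_of_pos_right one_lt_two hn))
  exact mem_iUnion₂.2 ⟨y, hy, mem_cell_of_dist_lt h1 hx (by rwa [dist_comm])⟩

theorem SeparatedByClopens.exists_notMem_cell [CompactSpace K] (hC : SeparatedByClopens C)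
    (hx : x ∈ C) (hy : y ∈ C) (hxy : x ≠ y) : ∃ n, y ∉ cell C n x := by
  obtain ⟨P, Q, hP, hQ, hPQ, rfl, hxP, hyQ⟩ := hC x hx y hy hxy
  obtain ⟨δ, hδ, h⟩ := hPQ.exists_thickenings hP.isCompact hQ
  obtain ⟨n, hn⟩ := exists_nat_one_div_lt (show 0 < δ / 6 by positivity)
  have hn6 : 2 / ((n : ℝ) + 1) < δ / 3 := by
    rw [show (2 : ℝ) / (n + 1) = 2 * (1 / (n + 1)) by ring]
    linarith
  have hPQδ : ∀ p ∈ P, ∀ q ∈ Q, δ ≤ dist q p := fun p hp q hq => by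
    by_contra! hlt
    exact disjoint_left.1 h (Metric.mem_thickening_iff.2 ⟨p, hp, hlt⟩)
      (Metric.self_subset_thickening hδ Q hq)
  refine ⟨n, fun hyx => ?_⟩
  have hsat : IsChainSaturated (P ∪ Q) n (Metric.thickening (2 / (n + 1)) P) := by
    suffices H : ∀ u w : K, w ∈ collar (P ∪ Q) n → dist u w < 2 / (n + 1) →
        u ∈ Metric.thickening (2 / (n + 1)) P → w ∈ Metric.thickening (2 / (n + 1)) P from
      fun u hu w hw huw => ⟨H u w hw huw, H w u hu (by rwa [dist_comm])⟩
    intro u w hw huw hu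
    obtain ⟨p, hp, hup⟩ := Metric.mem_thickening_iff.1 hu
    obtain ⟨q, hq | hq, hwq⟩ := exists_dist_lt_of_mem_collar hw
    · exact Metric.mem_thickening_iff.2 ⟨q, hq, hwq⟩
    · have h1 := hPQδ p hp q hq
      have h2 := dist_triangle4 q w u p
      rw [dist_comm q w, dist_comm w u] at h2
      linarith
  obtain ⟨p, hp, hyp⟩ := Metric.mem_thickening_iff.1
    ((hyx.2 _ hsat).1 (Metric.self_subset_thickening (by positivity) P hxP))
  have := hPQδ p hp y hyQ
  linarith

theorem SeparatedByClopens.exists_cell_subset [CompactSpace K] (hC : SeparatedByClopens C)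
    (hCc : IsClosed C) (hx : x ∈ C) {U : Set K} (hU : IsOpen U) (hxU : x ∈ U) :
    ∃ n, cell C n x ⊆ U := by
  have hxn : ∀ n, x ∈ cell C n x := fun n => mem_cell_self (subset_collar C n hx)
  have hdir : Directed (· ⊇ ·) fun n => cell C n x := Antitone.directed_ge fun n m h =>
    cell_subset_cell h (hxn n) (hxn m)
  refine exists_subset_nhds_of_isCompact' hdir (fun n => (isClosed_cell C n x).isCompact)
    (fun n => isClosed_cell C n x) fun y hy => ?_
  have hyC : y ∈ C := by
    by_contra hyC
    obtain ⟨n, hn⟩ := exists_notMem_collar hCc hyC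
    exact hn (mem_iInter.1 hy n).1
  by_cases hxy : x = y
  · exact hxy ▸ hU.mem_nhds hxU
  · obtain ⟨n, hn⟩ := hC.exists_notMem_cell hx hyC hxy
    exact absurd (mem_iInter.1 hy n) hn

theorem cellTraces_subset_or_subset {A B : Set K} (hA : A ∈ cellTraces C Y)
    (hB : B ∈ cellTraces C Y) (h : (A ∩ B).Nonempty) : A ⊆ B ∨ B ⊆ A := by
  obtain ⟨n, -, c, -, rfl⟩ := hA
  obtain ⟨m, -, c', -, rfl⟩ := hB
  rcases cell_subset_or_subset (h.mono (inter_subset_inter inter_subset_left inter_subset_left))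
    with h | h
  · exact Or.inl (inter_subset_inter_left _ h)
  · exact Or.inr (inter_subset_inter_left _ h)

theorem isClosed_of_mem_cellTraces (hY : IsClosed Y) {A : Set K} (hA : A ∈ cellTraces C Y) :
    IsClosed A := by
  obtain ⟨n, -, c, -, rfl⟩ := hA
  exact (isClosed_cell C n c).inter hY

theorem isBinary_cellTraces [CompactSpace K] (hY : IsClosed Y) : IsBinary (cellTraces C Y) :=
  fun _ hL hne hlink => nonempty_sInter_of_chain hne
    (fun _ hA => isClosed_of_mem_cellTraces hY (hL hA)) (fun A hA => (hlink A hA A hA).left)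
    (fun A hA B hB => cellTraces_subset_or_subset (hL hA) (hL hB) (hlink A hA B hB))

theorem exists_finite_cellTraces_cover [CompactSpace K] (h : Y ⊆ collar C n) :
    ∃ s ⊆ C, s.Finite ∧ Y ⊆ ⋃₀ ((fun c => cell C n c ∩ Y) '' s) ∧
      (fun c => cell C n c ∩ Y) '' s ⊆ cellTraces C Y := by
  obtain ⟨s, hsC, hs, hcov⟩ := exists_finite_cells_cover C n
  refine ⟨s, hsC, hs, fun y hy => ?_, ?_⟩
  · obtain ⟨c, hc, hyc⟩ := mem_iUnion₂.1 (hcov (h hy))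
    exact ⟨_, mem_image_of_mem _ hc, hyc, hy⟩
  · rintro _ ⟨c, hc, rfl⟩
    exact ⟨n, h, c, hsC hc, rfl⟩

theorem SeparatedByClopens.isClosedSubbaseOn_cellTraces [CompactSpace K]
    (hC : SeparatedByClopens C) (hCc : IsClosed C) (hYC : Y ⊆ C) :
    IsClosedSubbaseOn (cellTraces C Y) Y := by
  intro x hx U hU hxU
  obtain ⟨n, hn⟩ := hC.exists_cell_subset hCc (hYC hx) hU hxU
  obtain ⟨s, hsC, hs, hcov, htr⟩ :=
    exists_finite_cellTraces_cover (n := n) (hYC.trans (subset_collar C n))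
  refine ⟨{A ∈ (fun c => cell C n c ∩ Y) '' s | x ∉ A}, (sep_subset _ _).trans htr,
    (hs.image _).subset (sep_subset _ _), fun ⟨A, hA, hxA⟩ => hA.2 hxA, ?_⟩
  rintro y ⟨hy, hyU⟩
  obtain ⟨A, hA, hyA⟩ := hcov hy
  refine ⟨A, ⟨hA, fun hxA => hyU (hn ?_)⟩, hyA⟩
  obtain ⟨c, -, rfl⟩ := hA
  exact cell_subset_cell le_rfl (mem_cell_self (subset_collar C n (hYC hx))) hxA.1 hyA.1

theorem SeparatedByClopens.exists_isBinary_isClosedSubbaseOn [CompactSpace K]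
    (hC : SeparatedByClopens C) (hCc : IsClosed C) (hY : IsClosed Y) :
    ∃ 𝒢 : Set (Set K), cellTraces C Y ⊆ 𝒢 ∧ (∀ G ∈ 𝒢, IsClosed G ∧ G ⊆ Y) ∧ IsBinary 𝒢 ∧
      IsClosedSubbaseOn 𝒢 Y ∧ ∃ ℬ ⊆ 𝒢, ℬ.Finite ∧ Y ⊆ ⋃₀ ℬ := by
  have htr : ∀ A ∈ cellTraces C Y, IsClosed A ∧ A ⊆ Y := fun A hA =>
    ⟨isClosed_of_mem_cellTraces hY hA, by
      obtain ⟨n, -, c, -, rfl⟩ := hA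
      exact inter_subset_right⟩
  by_cases hYC : Y ⊆ C
  · obtain ⟨s, -, hs, hcov, hs'⟩ :=
      exists_finite_cellTraces_cover (n := 0) (hYC.trans (subset_collar C 0))
    exact ⟨cellTraces C Y, Subset.rfl, htr, isBinary_cellTraces hY,
      hC.isClosedSubbaseOn_cellTraces hCc hYC, _, hs', hs.image _, hcov⟩
  obtain ⟨y₀, hy₀, hy₀C⟩ := not_subset.1 hYC
  obtain ⟨n₀, hn₀⟩ := exists_notMem_collar hCc hy₀C
  have := isCompact_iff_compactSpace.1 hY.isCompact
  obtain ⟨ℱ, hcl, hb, hsmall, hcov⟩ :=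
    exists_isBinary_small_covers Y (ε := 1 / (n₀ + 1)) (by positivity)
  have himg : ∀ F : Set Y, (Subtype.val '' F : Set K) ⊆ Y := fun F => by
    rintro _ ⟨y, -, rfl⟩
    exact y.2
  have hcompat : ∀ A ∈ cellTraces C Y, ∀ F ∈ ℱ, (Subtype.val '' F ∩ A).Nonempty →
      Subtype.val '' F ⊆ A := by
    rintro _ ⟨n, hn, c, -, rfl⟩ F hF ⟨_, ⟨x, hx, rfl⟩, hxc, -⟩
    rintro _ ⟨y, hy, rfl⟩
    refine ⟨mem_cell_of_dist_lt hxc (hn y.2) ((hsmall F hF x hx y hy).trans_lt ?_), y.2⟩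
    have hnn₀ : n ≤ n₀ := by
      by_contra! hlt
      exact hn₀ (collar_anti C hlt.le (hn hy₀))
    have hn1 : (0 : ℝ) < n + 1 := by positivity
    calc 1 / ((n₀ : ℝ) + 1) ≤ 1 / (n + 1) := by gcongr
      _ < 2 / (n + 1) := div_lt_div_of_pos_right one_lt_two hn1
  refine ⟨cellTraces C Y ∪ (Subtype.val '' ·) '' ℱ, subset_union_left, ?_, ?_, ?_, ?_⟩
  · rintro _ (hA | ⟨F, hF, rfl⟩)
    · exact htr _ hA
    · exact ⟨hY.isClosedEmbedding_subtypeVal.isClosedMap F (hcl F hF), himg F⟩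
  · intro L hL hne hlink
    by_cases hLF : ∃ F ∈ ℱ, Subtype.val '' F ∈ L
    · obtain ⟨F, hF, hFL⟩ := hLF
      obtain ⟨z, hz⟩ := hb {G ∈ ℱ | Subtype.val '' G ∈ L} (sep_subset _ _) ⟨F, hF, hFL⟩
        fun G hG H hH => by
          have h := hlink _ hG.2 _ hH.2
          rw [← image_inter Subtype.val_injective] at h
          exact h.of_image
      refine ⟨z, fun A hA => ?_⟩
      rcases hL hA with hA' | ⟨G, hG, rfl⟩
      · exact hcompat A hA' F hF (hlink _ hFL A hA) ⟨z, hz F ⟨hF, hFL⟩, rfl⟩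
      · exact ⟨z, hz G ⟨hG, hA⟩, rfl⟩
    · refine isBinary_cellTraces (C := C) hY L (fun A hA => ?_) hne hlink
      rcases hL hA with hA' | ⟨G, hG, rfl⟩
      · exact hA'
      · exact absurd ⟨G, hG, hA⟩ hLF
  · intro x hx U hU hxU
    obtain ⟨η, hη, hηU⟩ := Metric.isOpen_iff.1 hU x hxU
    obtain ⟨ℬ, hℬ, hfin, hun, hℬη⟩ := hcov (η / 2) (half_pos hη)
    refine ⟨(Subtype.val '' ·) '' {B ∈ ℬ | (⟨x, hx⟩ : Y) ∉ B},
      (image_mono ((sep_subset _ _).trans hℬ)).trans subset_union_right,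
      (hfin.subset (sep_subset _ _)).image _, ?_, ?_⟩
    · rintro ⟨_, ⟨B, hB, rfl⟩, ⟨y, hyB, hyx⟩⟩
      exact hB.2 ((Subtype.ext hyx : y = ⟨x, hx⟩) ▸ hyB)
    · rintro y ⟨hy, hyU⟩
      obtain ⟨B, hB, hyB⟩ : (⟨y, hy⟩ : Y) ∈ ⋃₀ ℬ := hun ▸ mem_univ _
      refine ⟨_, mem_image_of_mem _ ⟨hB, fun hxB => hyU (hηU ?_)⟩, ⟨y, hy⟩, hyB, rfl⟩
      have h : dist y x ≤ η / 2 := hℬη B hB _ hyB _ hxB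
      exact Metric.mem_ball.2 (by linarith)
  · obtain ⟨ℬ, hℬ, hfin, hun, -⟩ := hcov 1 one_pos
    refine ⟨_, (image_mono hℬ).trans subset_union_right, hfin.image _, fun y hy => ?_⟩
    obtain ⟨B, hB, hyB⟩ : (⟨y, hy⟩ : Y) ∈ ⋃₀ ℬ := hun ▸ mem_univ _
    exact ⟨_, mem_image_of_mem _ hB, ⟨y, hy⟩, hyB, rfl⟩

end Collar

theorem SeparatedByClopens.of_isTopologicalBasis {K : Type*} [MetricSpace K] {C : Set K}
    (hC : IsClosed C) {B : Set (Set C)} (hB : ∀ s ∈ B, IsClopen s)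
    (hbasis : IsTopologicalBasis B) : SeparatedByClopens C := by
  intro x hx y hy hxy
  obtain ⟨s, hs, hxs, hsy⟩ := hbasis.exists_subset_of_mem_open (a := (⟨x, hx⟩ : C))
    (u := {(⟨y, hy⟩ : C)}ᶜ) (fun h => hxy (congrArg Subtype.val h)) isOpen_compl_singleton
  have hmap := hC.isClosedEmbedding_subtypeVal.isClosedMap
  refine ⟨Subtype.val '' s, Subtype.val '' sᶜ, hmap _ (hB s hs).isClosed,
    hmap _ (hB s hs).compl.isClosed, (disjoint_image_iff Subtype.val_injective).2
      disjoint_compl_right, ?_, ⟨_, hxs, rfl⟩, ⟨⟨y, hy⟩, fun h => hsy h rfl, rfl⟩⟩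
  rw [← image_union, union_compl_self, image_univ, Subtype.range_coe]

section OnePointProduct

variable {K : Type*} {D : Type*}

/-- The section of `X` over the index `i`. -/
def fiber (X : Set (K × OnePoint D)) (i : OnePoint D) : Set K := {x | (x, i) ∈ X}

/-- The copy of a subset `G` of the section of `X` over `d` inside `X`. -/
def fiberLift (X : Set (K × OnePoint D)) (d : D) (G : Set K) : Set X :=
  {p | p.1.2 = (d : OnePoint D) ∧ p.1.1 ∈ G}

/-- The part of `X` lying over the cell of `c` at level `n`, restricted to the indices outside
`E` whose section lies in the collar of the section at infinity. -/
def cellLift [MetricSpace K] (X : Set (K × OnePoint D)) (n : ℕ) (c : K) (E : Set D) : Set X :=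
  {p | (fiber X p.1.2 ⊆ collar (fiber X OnePoint.infty) n ∧ p.1.2 ∉ ((↑) : D → OnePoint D) '' E) ∧
    p.1.1 ∈ cell (fiber X OnePoint.infty) n c}

/-- The lifts of the cells around the section at infinity, together with the lifts of the
members of given families on the sections over the points of `D`. -/
def liftFamily [MetricSpace K] (X : Set (K × OnePoint D)) (𝒢 : D → Set (Set K)) : Set (Set X) :=
  {A | (∃ n, ∃ c ∈ fiber X OnePoint.infty, ∃ E : Set D, A = cellLift X n c E) ∨
    ∃ d, ∃ G ∈ 𝒢 d, A = fiberLift X d G}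

variable {X : Set (K × OnePoint D)} {𝒢 : D → Set (Set K)}

theorem cell_inter_nonempty_of_cellLift [MetricSpace K] {n m : ℕ} {c c' : K} {E E' : Set D}
    (h : (cellLift X n c E ∩ cellLift X m c' E').Nonempty) :
    (cell (fiber X OnePoint.infty) n c ∩ cell (fiber X OnePoint.infty) m c').Nonempty := by
  obtain ⟨p, hp, hp'⟩ := h
  exact ⟨p.1.1, hp.2, hp'.2⟩

variable [TopologicalSpace D]

theorem isClosed_fiber [TopologicalSpace K] (hX : IsClosed X) (i : OnePoint D) :
    IsClosed (fiber X i) :=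
  hX.preimage (by fun_prop : Continuous fun x : K => (x, i))

theorem isBinary_liftFamily [MetricSpace K] [CompactSpace K] (hX : IsClosed X)
    (htr : ∀ d : D, cellTraces (fiber X OnePoint.infty) (fiber X (d : OnePoint D)) ⊆ 𝒢 d)
    (hsub : ∀ d : D, ∀ G ∈ 𝒢 d, G ⊆ fiber X (d : OnePoint D)) (hb : ∀ d, IsBinary (𝒢 d)) :
    IsBinary (liftFamily X 𝒢) := by
  intro L hL hne hlink
  set C := fiber X (OnePoint.infty : OnePoint D) with hC
  by_cases hLF : ∃ d, ∃ G ∈ 𝒢 d, fiberLift X d G ∈ L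
  · obtain ⟨d, G₀, hG₀, hG₀L⟩ := hLF
    have hkey : ∀ A ∈ L, ∃ G ∈ 𝒢 d, (∀ x (hx : (x, (d : OnePoint D)) ∈ X), x ∈ G ↔
        (⟨(x, d), hx⟩ : X) ∈ A) := by
      intro A hA
      obtain ⟨p, hpA, hpd, hpG⟩ := hlink A hA _ hG₀L
      rcases hL hA with ⟨n, c, hc, E, rfl⟩ | ⟨d', G, hG, rfl⟩
      · rw [cellLift, mem_ofPred_eq, hpd] at hpA
        exact ⟨_, htr d ⟨n, hpA.1.1, c, hc, rfl⟩, fun x hx =>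
          ⟨fun h => ⟨hpA.1, h.1⟩, fun h => ⟨h.2, hx⟩⟩⟩
      · obtain rfl : d = d' := OnePoint.coe_injective (hpd.symm.trans hpA.1)
        exact ⟨G, hG, fun x hx => ⟨fun h => ⟨rfl, h⟩, fun h => h.2⟩⟩
    choose! T hT hTA using hkey
    have hpair : ∀ A ∈ L, ∀ B ∈ L, (T A ∩ T B).Nonempty := by
      intro A hA B hB
      suffices H : ∃ p : X, p ∈ A ∧ p ∈ B ∧ p.1.2 = (d : OnePoint D) by
        obtain ⟨⟨⟨x, i⟩, hp⟩, hpA, hpB, hpd⟩ := H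
        obtain rfl : i = d := hpd
        exact ⟨x, (hTA A hA x hp).2 hpA, (hTA B hB x hp).2 hpB⟩
      obtain ⟨p, hpA, hpB⟩ := hlink A hA B hB
      obtain ⟨q, hqA, hqd, -⟩ := hlink A hA _ hG₀L
      obtain ⟨r, hrB, hrd, -⟩ := hlink B hB _ hG₀L
      rcases hL hA with ⟨n, c, hc, E, rfl⟩ | ⟨d', G, hG, rfl⟩
      · rcases hL hB with ⟨m, c', hc', E', rfl⟩ | ⟨d', G, hG, rfl⟩
        · rcases cell_subset_or_subset (cell_inter_nonempty_of_cellLift ⟨p, hpA, hpB⟩) with h | h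
          · exact ⟨q, hqA, ⟨by rw [hqd, ← hrd]; exact hrB.1, h hqA.2⟩, hqd⟩
          · exact ⟨r, ⟨by rw [hrd, ← hqd]; exact hqA.1, h hrB.2⟩, hrB, hrd⟩
        · exact ⟨p, hpA, hpB, hpB.1.trans (hrB.1.symm.trans hrd)⟩
      · exact ⟨p, hpA, hpB, hpA.1.trans (hqA.1.symm.trans hqd)⟩
    obtain ⟨z, hz⟩ := hb d (T '' L) (by rintro _ ⟨A, hA, rfl⟩; exact hT A hA) (hne.image T) (by
      rintro _ ⟨A, hA, rfl⟩ _ ⟨B, hB, rfl⟩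
      exact hpair A hA B hB)
    have hzX : (z, (d : OnePoint D)) ∈ X := hsub d _ (hT _ hG₀L) (hz _ (mem_image_of_mem T hG₀L))
    exact ⟨⟨(z, d), hzX⟩, fun A hA => (hTA A hA z hzX).1 (hz _ (mem_image_of_mem T hA))⟩
  · have hcell : ∀ A ∈ L, ∃ n, ∃ c ∈ C, ∃ E : Set D, A = cellLift X n c E := fun A hA => by
      rcases hL hA with h | ⟨d, G, hG, rfl⟩
      · exact h
      · exact absurd ⟨d, G, hG, hA⟩ hLF
    have : Nonempty K := let ⟨A, hA⟩ := hne; let ⟨_, c, _⟩ := hcell A hA; ⟨c⟩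
    choose! N c hc E hE using hcell
    have hlink' : ∀ A ∈ L, ∀ B ∈ L, (cell C (N A) (c A) ∩ cell C (N B) (c B)).Nonempty :=
      fun A hA B hB => by
        have h := hlink A hA B hB
        rw [hE A hA, hE B hB] at h
        exact cell_inter_nonempty_of_cellLift h
    obtain ⟨z, hz⟩ := nonempty_sInter_of_chain (L := (fun A => cell C (N A) (c A) ∩ C) '' L)
      (hne.image _)
      (by
        rintro _ ⟨A, hA, rfl⟩
        exact (isClosed_cell C _ _).inter (isClosed_fiber hX _))
      (by
        rintro _ ⟨A, hA, rfl⟩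
        exact ⟨c A, mem_cell_self (subset_collar C _ (hc A hA)), hc A hA⟩)
      (by
        rintro _ ⟨A, hA, rfl⟩ _ ⟨B, hB, rfl⟩
        exact (cell_subset_or_subset (hlink' A hA B hB)).imp (inter_subset_inter_left _)
          (inter_subset_inter_left _))
    have hzX : z ∈ C := by
      obtain ⟨A, hA⟩ := hne
      exact (hz _ (mem_image_of_mem _ hA)).2
    refine ⟨⟨(z, OnePoint.infty), hzX⟩, fun A hA => ?_⟩
    rw [hE A hA]
    exact ⟨⟨subset_collar C _, by simp⟩, (hz _ (mem_image_of_mem _ hA)).1⟩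

variable [DiscreteTopology D]

theorem OnePoint.isClosed_of_infty_mem {s : Set (OnePoint D)} (h : OnePoint.infty ∈ s) :
    IsClosed s :=
  isOpen_compl_iff.1 ((OnePoint.isOpen_iff_of_notMem fun h' => absurd h h').2 (isOpen_discrete _))

theorem OnePoint.finite_of_isOpen {s : Set (OnePoint D)} (hs : IsOpen s) (h : OnePoint.infty ∈ s) :
    {d : D | (d : OnePoint D) ∉ s}.Finite :=
  isCompact_iff_finite.1 ((OnePoint.isOpen_iff_of_mem h).1 hs).2

theorem isClosed_fiberLift [TopologicalSpace K] (d : D) {G : Set K} (hG : IsClosed G) :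
    IsClosed (fiberLift X d G) :=
  (isClosed_singleton.preimage
    (by fun_prop : Continuous fun p : X => p.1.2)).inter
    (hG.preimage (by fun_prop : Continuous fun p : X => p.1.1))

theorem finite_fiber_not_subset [TopologicalSpace K] [CompactSpace K] (hX : IsClosed X)
    {U : Set K} (hU : IsOpen U) (h : fiber X OnePoint.infty ⊆ U) :
    {d : D | ¬ fiber X (d : OnePoint D) ⊆ U}.Finite := by
  have hcl : IsClosed (Prod.snd '' (X ∩ Uᶜ ×ˢ univ)) :=
    ((hX.inter (hU.isClosed_compl.prod isClosed_univ)).isCompact.image continuous_snd).isClosed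
  refine (OnePoint.finite_of_isOpen hcl.isOpen_compl ?_).subset fun d hd => ?_
  · rintro ⟨⟨x, i⟩, ⟨hx, hxU, -⟩, rfl⟩
    exact hxU (h hx)
  · obtain ⟨x, hx, hxU⟩ := not_subset.1 hd
    exact fun h' => h' ⟨(x, d), ⟨hx, hxU, trivial⟩, rfl⟩

theorem isClosed_cellLift [MetricSpace K] (n : ℕ) (c : K) (E : Set D) :
    IsClosed (cellLift X n c E) := by
  refine IsClosed.inter (IsClosed.preimage (by fun_prop : Continuous fun p : X => p.1.2)
    (OnePoint.isClosed_of_infty_mem (s := {i | fiber X i ⊆ collar (fiber X OnePoint.infty) n ∧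
      i ∉ ((↑) : D → OnePoint D) '' E}) ⟨subset_collar _ n, by simp⟩))
    ((isClosed_cell _ n c).preimage (by fun_prop : Continuous fun p : X => p.1.1))

theorem exists_finite_liftFamily_cover [MetricSpace K] [CompactSpace K] (hX : IsClosed X)
    (hcov : ∀ d : D, ∃ ℬ ⊆ 𝒢 d, ℬ.Finite ∧ fiber X (d : OnePoint D) ⊆ ⋃₀ ℬ) (n : ℕ) {E : Set D}
    (hE : E.Finite) : ∃ ℬ ⊆ liftFamily X 𝒢, ℬ.Finite ∧ ⋃₀ ℬ = univ ∧
      ∀ A ∈ ℬ, (∃ c, A = cellLift X n c E) ∨ ∃ d G, A = fiberLift X d G := by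
  choose ℬ hℬ hfin hcov using hcov
  obtain ⟨s, hsC, hs, hscov⟩ := exists_finite_cells_cover (fiber X (OnePoint.infty : OnePoint D)) n
  have hbad : {d : D | ¬ fiber X (d : OnePoint D) ⊆ collar (fiber X OnePoint.infty) n}.Finite :=
    (finite_fiber_not_subset hX (Metric.isOpen_thickening (δ := 1 / (n + 1)))
      (Metric.self_subset_thickening (by positivity) _)).subset fun d hd h =>
        hd (h.trans (Metric.thickening_subset_cthickening _ _))
  refine ⟨(fun c => cellLift X n c E) '' s ∪ ⋃ d ∈ E ∪ {d : D |
      ¬ fiber X (d : OnePoint D) ⊆ collar (fiber X OnePoint.infty) n}, fiberLift X d '' ℬ d,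
    ?_, (hs.image _).union ((hE.union hbad).biUnion fun d _ => (hfin d).image _), ?_, ?_⟩
  · rintro _ (⟨c, hc, rfl⟩ | hA)
    · exact Or.inl ⟨n, c, hsC hc, E, rfl⟩
    · obtain ⟨d, -, G, hG, rfl⟩ := mem_iUnion₂.1 hA
      exact Or.inr ⟨d, G, hℬ d hG, rfl⟩
  · refine eq_univ_of_forall fun ⟨⟨x, i⟩, hp⟩ => ?_
    by_cases h : fiber X i ⊆ collar (fiber X OnePoint.infty) n ∧ i ∉ ((↑) : D → OnePoint D) '' E
    · obtain ⟨c, hc, hxc⟩ := mem_iUnion₂.1 (hscov (h.1 hp))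
      exact ⟨_, Or.inl (mem_image_of_mem _ hc), h, hxc⟩
    · induction i using OnePoint.rec with
      | infty => exact absurd ⟨subset_collar _ n, by simp⟩ h
      | coe d =>
        obtain ⟨G, hG, hxG⟩ := hcov d hp
        refine ⟨_, Or.inr (mem_iUnion₂.2 ⟨d, ?_, G, hG, rfl⟩), rfl, hxG⟩
        by_contra hd
        rw [mem_union, not_or] at hd
        refine h ⟨not_not.1 hd.2, ?_⟩
        rintro ⟨e, he, hed⟩
        exact hd.1 (OnePoint.coe_injective hed ▸ he)
  · rintro _ (⟨c, hc, rfl⟩ | hA)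
    · exact Or.inl ⟨c, rfl⟩
    · obtain ⟨d, -, G, hG, rfl⟩ := mem_iUnion₂.1 hA
      exact Or.inr ⟨d, G, rfl⟩

theorem isClosedSubbaseOn_liftFamily [MetricSpace K] [CompactSpace K] (hX : IsClosed X)
    (hC : SeparatedByClopens (fiber X (OnePoint.infty : OnePoint D)))
    (hs : ∀ d : D, IsClosedSubbaseOn (𝒢 d) (fiber X (d : OnePoint D)))
    (hcov : ∀ d : D, ∃ ℬ ⊆ 𝒢 d, ℬ.Finite ∧ fiber X (d : OnePoint D) ⊆ ⋃₀ ℬ) :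
    IsClosedSubbaseOn (liftFamily X 𝒢) univ := by
  rintro ⟨⟨x, i⟩, hp⟩ - U hU hpU
  obtain ⟨U', hU', rfl⟩ := isOpen_induced_iff.1 hU
  obtain ⟨V, A, hV, hA, hxV, hiA, hVA⟩ := isOpen_prod_iff.1 hU' x i hpU
  induction i using OnePoint.rec with
  | infty =>
    obtain ⟨n, hn⟩ := hC.exists_cell_subset (isClosed_fiber hX _) hp hV hxV
    obtain ⟨ℬ, hℬ, hfin, hun, hform⟩ :=
      exists_finite_liftFamily_cover hX hcov n (OnePoint.finite_of_isOpen hA hiA)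
    refine ⟨{B ∈ ℬ | (⟨(x, OnePoint.infty), hp⟩ : X) ∉ B}, (sep_subset _ _).trans hℬ,
      hfin.subset (sep_subset _ _), fun ⟨B, hB, hxB⟩ => hB.2 hxB, ?_⟩
    rintro ⟨⟨y, j⟩, hq⟩ ⟨-, hqU⟩
    obtain ⟨B, hB, hqB⟩ := hun.symm ▸ mem_univ (⟨(y, j), hq⟩ : X)
    refine ⟨B, ⟨hB, fun hpB => hqU (hVA ?_)⟩, hqB⟩
    rcases hform B hB with ⟨c, rfl⟩ | ⟨d, G, rfl⟩
    · have hxn := mem_cell_self (subset_collar (fiber X OnePoint.infty) n hp)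
      refine ⟨hn (cell_subset_cell le_rfl hxn hpB.2 hqB.2), ?_⟩
      by_contra hj
      induction j using OnePoint.rec with
      | infty => exact hj hiA
      | coe d => exact hqB.1.2 ⟨d, hj, rfl⟩
    · exact absurd hpB.1 (OnePoint.infty_ne_coe d)
  | coe d =>
    obtain ⟨𝒜, h𝒜, h𝒜fin, hx𝒜, hU𝒜⟩ := hs d x hp V hV hxV
    obtain ⟨ℬ, hℬ, hfin, hun, hform⟩ :=
      exists_finite_liftFamily_cover hX hcov 0 (finite_singleton d)
    refine ⟨{B ∈ ℬ | (⟨(x, d), hp⟩ : X) ∉ B} ∪ fiberLift X d '' 𝒜,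
      union_subset ((sep_subset _ _).trans hℬ) ?_,
      (hfin.subset (sep_subset _ _)).union (h𝒜fin.image _), ?_, ?_⟩
    · rintro _ ⟨G, hG, rfl⟩
      exact Or.inr ⟨d, G, h𝒜 hG, rfl⟩
    · rintro ⟨_, hB | ⟨G, hG, rfl⟩, hxB⟩
      · exact hB.2 hxB
      · exact hx𝒜 ⟨G, hG, hxB.2⟩
    · rintro ⟨⟨y, j⟩, hq⟩ ⟨-, hqU⟩
      by_cases hj : j = d
      · subst hj
        obtain ⟨G, hG, hyG⟩ := hU𝒜 ⟨hq, fun hyV => hqU (hVA ⟨hyV, hiA⟩)⟩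
        exact ⟨_, Or.inr (mem_image_of_mem _ hG), rfl, hyG⟩
      · obtain ⟨B, hB, hqB⟩ := hun.symm ▸ mem_univ (⟨(y, j), hq⟩ : X)
        refine ⟨B, Or.inl ⟨hB, fun hpB => hj ?_⟩, hqB⟩
        rcases hform B hB with ⟨c, rfl⟩ | ⟨e, G, rfl⟩
        · exact absurd ⟨d, rfl, rfl⟩ hpB.1.2
        · exact hqB.1.trans hpB.1.symm

theorem SeparatedByClopens.isSupercompact [MetricSpace K] [CompactSpace K] (hX : IsClosed X)
    (hC : SeparatedByClopens (fiber X (OnePoint.infty : OnePoint D))) : IsSupercompact X := by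
  choose 𝒢 htr hcl hb hs hcov using fun d : D => hC.exists_isBinary_isClosedSubbaseOn
    (isClosed_fiber hX _) (isClosed_fiber hX (d : OnePoint D))
  refine IsBinary.isSupercompact (𝒮 := liftFamily X 𝒢) ?_
    (isBinary_liftFamily hX htr (fun d G hG => (hcl d G hG).2) hb)
    (isClosedSubbaseOn_liftFamily hX hC hs hcov)
  rintro _ (⟨n, c, -, E, rfl⟩ | ⟨d, G, hG, rfl⟩)
  · exact isClosed_cellLift n c E
  · exact isClosed_fiberLift d (hcl d G hG).1

end OnePointProduct

/-- Let `K` be a compact metrizable space, `D` a discrete space, and `X ⊆ K × αD` a closed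
subspace.  If the section `X_∞ = {x ∈ K : (x,∞) ∈ X}` is zero-dimensional (has a base of
clopen sets), then `X` is supercompact. -/
theorem supercompact_of_zeroDim_infinity_section
    (K : Type u) [TopologicalSpace K] [CompactSpace K] [TopologicalSpace.MetrizableSpace K]
    (D : Type v) [TopologicalSpace D] [DiscreteTopology D]
    (X : Set (K × OnePoint D)) (hX : IsClosed X)
    (h0 : ∃ B : Set (Set {x : K // (x, (OnePoint.infty : OnePoint D)) ∈ X}),
      (∀ s ∈ B, IsClopen s) ∧ IsTopologicalBasis B) :
    IsSupercompact X := by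
  let _ := metrizableSpaceMetric K
  obtain ⟨B, hB, hbasis⟩ := h0
  exact (SeparatedByClopens.of_isTopologicalBasis (isClosed_fiber hX OnePoint.infty) hB
    hbasis).isSupercompact hX
end

section
/- For each zero-dimensional compact metrizable space K and each discrete space D, the product K × αD is hereditarily supercompact. -/
open Set Topology TopologicalSpace

universe u v

/-- A topological space is *hereditarily supercompact* if each of its closed subspaces is
supercompact. -/
def IsHereditarilySupercompact (X : Type*) [TopologicalSpace X] : Prop :=
  ∀ Z : Set X, IsClosed Z → IsSupercompact Z

/-- A second countable space with a base of clopen sets has a base of clopen sets any two of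
which are disjoint or comparable. -/
theorem exists_nested_clopen_basis (K : Type*) [TopologicalSpace K] [SecondCountableTopology K]
    (hK : ∃ B : Set (Set K), (∀ s ∈ B, IsClopen s) ∧ IsTopologicalBasis B) :
    ∃ B : Set (Set K), (∀ s ∈ B, IsClopen s) ∧ IsTopologicalBasis B ∧
      ∀ s ∈ B, ∀ t ∈ B, (s ∩ t).Nonempty → s ⊆ t ∨ t ⊆ s := by
  obtain ⟨B, hB, hBb⟩ := hK
  obtain ⟨B', hB'B, hB'c, hB'⟩ := hBb.exists_countable
  rcases isEmpty_or_nonempty K with hE | ⟨⟨x₀⟩⟩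
  · exact ⟨B, hB, hBb, fun s _ t _ ⟨x, _⟩ => (hE.false x).elim⟩
  obtain ⟨s₀, hs₀, -⟩ := hB'.exists_subset_of_mem_open (mem_univ x₀) isOpen_univ
  obtain ⟨f, hf⟩ := hB'c.exists_eq_range ⟨s₀, hs₀⟩
  have hfc : ∀ n, IsClopen (f n) := fun n => hB _ (hB'B (hf ▸ mem_range_self n))
  let cell : K → ℕ → Set K := fun x n => {y | ∀ i < n, (y ∈ f i ↔ x ∈ f i)}
  have hcell : ∀ x n, IsClopen (cell x n) := by
    intro x n
    have : cell x n = ⋂ i ∈ Set.Iio n, {y | y ∈ f i ↔ x ∈ f i} := by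
      ext y; simp [cell]
    rw [this]
    refine (Set.finite_Iio n).isClopen_biInter fun i _ => ?_
    by_cases hx : x ∈ f i
    · simpa [hx] using hfc i
    · simpa only [hx, iff_false] using! (hfc i).compl
  refine ⟨{s | ∃ x n, s = cell x n}, ?_, ?_, ?_⟩
  · rintro s ⟨x, n, rfl⟩
    exact hcell x n
  · refine isTopologicalBasis_of_isOpen_of_nhds ?_ ?_
    · rintro s ⟨x, n, rfl⟩
      exact (hcell x n).isOpen
    · intro x U hx hU
      obtain ⟨s, hs, hxs, hsU⟩ := hB'.exists_subset_of_mem_open hx hU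
      rw [hf] at hs
      obtain ⟨i, rfl⟩ := hs
      exact ⟨cell x (i + 1), ⟨x, i + 1, rfl⟩, fun _ _ => Iff.rfl,
        fun y hy => hsU ((hy i (Nat.lt_succ_self i)).2 hxs)⟩
  · rintro s ⟨x, n, rfl⟩ t ⟨y, m, rfl⟩ ⟨z, hzx, hzy⟩
    rcases le_total n m with h | h
    · exact Or.inr fun w hw i hi => (hw i (hi.trans_le h)).trans
        ((hzy i (hi.trans_le h)).symm.trans (hzx i hi))
    · exact Or.inl fun w hw i hi => (hw i (hi.trans_le h)).trans
        ((hzx i (hi.trans_le h)).symm.trans (hzy i hi))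

theorem IsCompact.exists_finite_subcover_sUnion {X : Type*} [TopologicalSpace X] {s : Set X}
    (hs : IsCompact s) {C : Set (Set X)} (hC : ∀ a ∈ C, IsOpen a) (hsC : s ⊆ ⋃₀ C) :
    ∃ T ⊆ C, T.Finite ∧ s ⊆ ⋃₀ T := by
  simp only [sUnion_eq_biUnion] at hsC ⊢
  exact hs.elim_finite_subcover_image hC hsC

/-- A Hausdorff topology coarser than a compact one is equal to it. -/
theorem eq_of_le_of_compact_of_t2 {X : Type*} {t τ : TopologicalSpace X} (h : t ≤ τ)
    (ht : @CompactSpace X t) (hτ : @T2Space X τ) : τ = t := by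
  refine le_antisymm ?_ h
  have hc : Continuous[t, τ] id := continuous_id_iff_le.2 h
  have hcl := @Continuous.isClosedMap X X t τ ht hτ id hc
  intro U hU
  have := hcl Uᶜ (@IsOpen.isClosed_compl X t U hU)
  rw [image_id] at this
  exact (@isClosed_compl_iff X τ U).1 this

/-- A compact subset of `OnePoint D`, for `D` discrete, that misses `∞` comes from a finite
subset of `D`. -/
theorem OnePoint.finite_preimage_of_isCompact {D : Type*} [TopologicalSpace D]
    [DiscreteTopology D] {s : Set (OnePoint D)} (hs : IsCompact s) (h : OnePoint.infty ∉ s) :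
    ((↑) ⁻¹' s : Set D).Finite :=
  isCompact_iff_finite.1 ((OnePoint.isClosed_iff_of_notMem h).1 hs.isClosed).2

theorem OnePoint.isClopen_singleton_coe {D : Type*} [TopologicalSpace D] [DiscreteTopology D]
    (d : D) : IsClopen {(d : OnePoint D)} :=
  ⟨isClosed_singleton, by
    simpa using OnePoint.isOpenEmbedding_coe.isOpenMap {d} (isOpen_discrete _)⟩

section

variable {K : Type*} {D : Type*}

/-- The trace on `Z` of the rectangle `N ×ˢ E`. -/
def rectTrace (Z : Set (K × OnePoint D)) (N : Set K) (E : Set (OnePoint D)) : Set Z :=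
  {z | z.1.1 ∈ N ∧ z.1.2 ∈ E}

/-- The rectangles with first side in `B` whose second side is either an isolated singleton, or
a clopen set containing `∞`, in which case the rectangle is required to meet `Z` at `∞`. -/
def IsBasicRect [TopologicalSpace D] (B : Set (Set K)) (Z : Set (K × OnePoint D)) (N : Set K)
    (E : Set (OnePoint D)) : Prop :=
  N ∈ B ∧ IsClopen E ∧
    ((OnePoint.infty ∈ E ∧ ∃ x ∈ N, (x, OnePoint.infty) ∈ Z) ∨ ∃ d : D, E = {(d : OnePoint D)})

/-- The complements in `Z` of the basic rectangles. -/
def rectSubbase [TopologicalSpace D] (B : Set (Set K)) (Z : Set (K × OnePoint D)) :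
    Set (Set Z) :=
  {a | ∃ N E, IsBasicRect B Z N E ∧ a = (rectTrace Z N E)ᶜ}

variable [TopologicalSpace K]

theorem isOpen_of_mem_rectSubbase [TopologicalSpace D] {B : Set (Set K)}
    (hBc : ∀ s ∈ B, IsClopen s) {Z : Set (K × OnePoint D)} {a : Set Z}
    (ha : a ∈ rectSubbase B Z) : IsOpen a := by
  obtain ⟨N, E, ⟨hN, hE, -⟩, rfl⟩ := ha
  have : IsClosed (rectTrace Z N E) :=
    ((hBc N hN).isClosed.prod hE.isClosed).preimage continuous_subtype_val
  exact this.isOpen_compl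

theorem isClosed_rectTrace [CompactSpace K] [TopologicalSpace D] [DiscreteTopology D]
    {B : Set (Set K)} (hBc : ∀ s ∈ B, IsClopen s) (hB : IsTopologicalBasis B)
    {Z : Set (K × OnePoint D)} (hZ : IsClosed Z) {U : Set K} (hU : IsClopen U)
    {E : Set (OnePoint D)} (hE : IsClopen E) :
    IsClosed[generateFrom (rectSubbase B Z)] (rectTrace Z U E) := by
  let τ : TopologicalSpace Z := generateFrom (rectSubbase B Z)
  have basic : ∀ N E, IsBasicRect B Z N E → IsClosed[τ] (rectTrace Z N E) := fun N E h =>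
    (@isOpen_compl_iff Z (rectTrace Z N E) τ).1 (isOpen_generateFrom_of_mem ⟨N, E, h, rfl⟩)
  have rectTrace_closed : ∀ N ∈ B, IsClosed[τ] (rectTrace Z N E) := by
    intro N hN
    by_cases h : OnePoint.infty ∈ E ∧ ∃ x ∈ N, (x, OnePoint.infty) ∈ Z
    · exact basic N E ⟨hN, hE, Or.inl h⟩
    have hcomp : IsCompact (Prod.snd '' (Z ∩ N ×ˢ E)) :=
      ((hZ.inter ((hBc N hN).isClosed.prod hE.isClosed)).isCompact).image continuous_snd
    have hfin := OnePoint.finite_preimage_of_isCompact hcomp (by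
      rintro ⟨⟨x, e⟩, ⟨hxZ, hxN, hxE⟩, rfl⟩
      exact h ⟨hxE, x, hxN, hxZ⟩)
    have heq : rectTrace Z N E = ⋃ d ∈ ((↑) ⁻¹' (Prod.snd '' (Z ∩ N ×ˢ E)) : Set D),
        rectTrace Z N {(d : OnePoint D)} := by
      ext ⟨⟨x, e⟩, hz⟩
      simp only [rectTrace, mem_ofPred_eq, mem_iUnion, mem_singleton_iff, exists_prop]
      constructor
      · rintro ⟨hx, he⟩
        induction e using OnePoint.rec with
        | infty => exact (h ⟨he, x, hx, hz⟩).elim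
        | coe d => exact ⟨d, ⟨(x, d), ⟨hz, hx, he⟩, rfl⟩, hx, rfl⟩
      · rintro ⟨d, ⟨⟨y, e'⟩, ⟨_, _, he'⟩, rfl⟩, hx, rfl⟩
        exact ⟨hx, he'⟩
    rw [heq]
    exact @Set.Finite.isClosed_biUnion Z D τ _ _ hfin fun d _ =>
      basic _ _ ⟨hN, OnePoint.isClopen_singleton_coe d, Or.inr ⟨d, rfl⟩⟩
  obtain ⟨F, hFB, hFfin, hUF⟩ : ∃ F ⊆ B, F.Finite ∧ U = ⋃₀ F := by
    obtain ⟨F, hFB, hF⟩ := hB.open_eq_sUnion hU.isOpen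
    obtain ⟨T, hTF, hTfin, hT⟩ := hU.isClosed.isCompact.exists_finite_subcover_sUnion
      (fun s hs => (hBc s (hFB hs)).isOpen) hF.subset
    exact ⟨T, hTF.trans hFB, hTfin, hT.antisymm (hF ▸ sUnion_subset_sUnion hTF)⟩
  have heq : rectTrace Z U E = ⋃ N ∈ F, rectTrace Z N E := by
    ext z
    simp only [rectTrace, hUF, mem_ofPred_eq, mem_sUnion, mem_iUnion, exists_prop]
    tauto
  rw [heq]
  exact @Set.Finite.isClosed_biUnion Z _ τ _ _ hFfin fun N hN => rectTrace_closed N (hFB hN)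

theorem generateFrom_rectSubbase [CompactSpace K] [T2Space K] [TopologicalSpace D]
    [DiscreteTopology D] {B : Set (Set K)} (hBc : ∀ s ∈ B, IsClopen s)
    (hB : IsTopologicalBasis B) {Z : Set (K × OnePoint D)} (hZ : IsClosed Z) :
    generateFrom (rectSubbase B Z) = instTopologicalSpaceSubtype := by
  refine eq_of_le_of_compact_of_t2
    (le_generateFrom fun a ha => isOpen_of_mem_rectSubbase hBc ha)
    (isCompact_iff_compactSpace.1 hZ.isCompact) ?_
  have key : ∀ (U : Set K) (E : Set (OnePoint D)), IsClopen U → IsClopen E →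
      IsOpen[generateFrom (rectSubbase B Z)] (rectTrace Z U E)ᶜ := fun U E hU hE =>
    (@isOpen_compl_iff Z _ (generateFrom (rectSubbase B Z))).2
      (isClosed_rectTrace hBc hB hZ hU hE)
  have sep : ∀ (U : Set K) (z w : Z), IsClopen U →
      z.1.1 ∈ U → w.1.1 ∉ U → ∃ u v : Set Z, IsOpen[generateFrom (rectSubbase B Z)] u ∧
        IsOpen[generateFrom (rectSubbase B Z)] v ∧ z ∈ u ∧ w ∈ v ∧ Disjoint u v := by
    intro U z w hU hz hw
    refine ⟨_, _, key Uᶜ univ hU.compl isClopen_univ, key U univ hU isClopen_univ, ?_, ?_, ?_⟩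
    · simpa [rectTrace] using hz
    · simpa [rectTrace] using hw
    · rw [Set.disjoint_left]
      simp [rectTrace]
  have sep' : ∀ (d : D) (z w : Z), z.1.2 = d → w.1.2 ≠ d →
      ∃ u v : Set Z, IsOpen[generateFrom (rectSubbase B Z)] u ∧
        IsOpen[generateFrom (rectSubbase B Z)] v ∧ z ∈ u ∧ w ∈ v ∧ Disjoint u v := by
    intro d z w hz hw
    have hd := OnePoint.isClopen_singleton_coe d
    refine ⟨_, _, key univ _ isClopen_univ hd.compl, key univ _ isClopen_univ hd, ?_, ?_, ?_⟩
    · simpa [rectTrace] using hz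
    · simpa [rectTrace] using hw
    · rw [Set.disjoint_left]
      simp [rectTrace]
  refine @T2Space.mk Z (generateFrom (rectSubbase B Z)) fun z w hzw => ?_
  by_cases h1 : z.1.1 = w.1.1
  · have h2 : z.1.2 ≠ w.1.2 := fun h2 => hzw (Subtype.ext (Prod.ext h1 h2))
    by_cases hz : z.1.2 = OnePoint.infty
    · obtain ⟨d, hd⟩ := OnePoint.ne_infty_iff_exists.1 (hz ▸ h2.symm : w.1.2 ≠ OnePoint.infty)
      obtain ⟨u, v, hu, hv, hwu, hzv, huv⟩ := sep' d w z hd.symm (hd ▸ h2)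
      exact ⟨v, u, hv, hu, hzv, hwu, huv.symm⟩
    · obtain ⟨d, hd⟩ := OnePoint.ne_infty_iff_exists.1 hz
      exact sep' d z w hd.symm (hd ▸ h2.symm)
  · obtain ⟨U, hUB, hzU, hU⟩ :=
      hB.exists_subset_of_mem_open (show z.1.1 ∈ ({w.1.1}ᶜ : Set K) from h1)
        isOpen_compl_singleton
    exact sep U z w (hBc U hUB) hzU fun h => hU h rfl

theorem rectSubbase_two_cover [CompactSpace K] [TopologicalSpace D]
    {B : Set (Set K)} (hBc : ∀ s ∈ B, IsClopen s)
    (hnest : ∀ s ∈ B, ∀ t ∈ B, (s ∩ t).Nonempty → s ⊆ t ∨ t ⊆ s)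
    {Z : Set (K × OnePoint D)} (hZ : IsClosed Z) {C : Set (Set Z)} (hC : C ⊆ rectSubbase B Z)
    (hcov : ⋃₀ C = univ) : ∃ T ⊆ C, T.Finite ∧ T.ncard ≤ 2 ∧ ⋃₀ T = univ := by
  have : CompactSpace Z := isCompact_iff_compactSpace.1 hZ.isCompact
  have hopen : ∀ a ∈ C, IsOpen a := fun a ha => isOpen_of_mem_rectSubbase hBc (hC ha)
  obtain ⟨T, hTC, hTfin, hT⟩ := isCompact_univ.exists_finite_subcover_sUnion hopen hcov.ge
  rcases T.eq_empty_or_nonempty with rfl | hTne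
  · exact ⟨∅, empty_subset _, finite_empty, by simp, univ_subset_iff.1 hT⟩
  by_contra hcon
  choose! N E hNE haNE using fun a (ha : a ∈ T) => hC (hTC ha)
  have link : ∀ a ∈ T, ∀ b ∈ T, ∃ z : Z, z ∈ rectTrace Z (N a) (E a) ∧
      z ∈ rectTrace Z (N b) (E b) := by
    intro a ha b hb
    by_contra! h
    refine hcon ⟨{a, b}, insert_subset (hTC ha) (singleton_subset_iff.2 (hTC hb)),
      by simp, (ncard_insert_le a {b}).trans (by simp), ?_⟩
    rw [sUnion_pair, eq_univ_iff_forall]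
    intro z
    by_cases hz : z ∈ rectTrace Z (N a) (E a)
    · exact Or.inr (by rw [haNE b hb]; exact h z hz)
    · exact Or.inl (by rw [haNE a ha]; exact hz)
  have missed : ¬ ∃ z : Z, ∀ a ∈ T, z ∈ rectTrace Z (N a) (E a) := by
    rintro ⟨z, hz⟩
    obtain ⟨a, ha, hza⟩ := hT (mem_univ z)
    rw [haNE a ha] at hza
    exact hza (hz a ha)
  obtain ⟨a₀, ha₀, hmin⟩ : ∃ a₀ ∈ T, ∀ b ∈ T, N a₀ ⊆ N b := by
    obtain ⟨a₀, ha₀, hmin⟩ := hTfin.exists_minimalFor N T hTne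
    refine ⟨a₀, ha₀, fun b hb => ?_⟩
    obtain ⟨z, hza, hzb⟩ := link a₀ ha₀ b hb
    rcases hnest _ (hNE a₀ ha₀).1 _ (hNE b hb).1 ⟨z.1.1, hza.1, hzb.1⟩ with h | h
    · exact h
    · exact hmin hb h
  by_cases hinf : ∀ a ∈ T, OnePoint.infty ∈ E a
  · rcases (hNE a₀ ha₀).2.2 with ⟨-, x, hx, hxZ⟩ | ⟨d, hd⟩
    · exact missed ⟨⟨_, hxZ⟩, fun b hb => ⟨hmin b hb hx, hinf b hb⟩⟩
    · have := hinf a₀ ha₀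
      rw [hd] at this
      exact OnePoint.infty_ne_coe d this
  · push Not at hinf
    obtain ⟨a, ha, hainf⟩ := hinf
    obtain ⟨d, hd⟩ := (hNE a ha).2.2.resolve_left fun h => hainf h.1
    have hmem : ∀ z : Z, z ∈ rectTrace Z (N a) (E a) → z.1.2 = d := fun z hz => by
      simpa [hd] using hz.2
    obtain ⟨z, hz₀, hza⟩ := link a₀ ha₀ a ha
    refine missed ⟨z, fun b hb => ⟨hmin b hb hz₀.1, ?_⟩⟩
    obtain ⟨w, hwb, hwa⟩ := link b hb a ha
    rw [hmem z hza, ← hmem w hwa]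
    exact hwb.2

end

/-- For each zero-dimensional compact metrizable space `K` (one with a base of clopen sets)
and each discrete space `D`, the product `K × αD` of `K` with the one-point
compactification of `D` is hereditarily supercompact. -/
theorem zeroDim_compact_metrizable_prod_onePoint_hereditarily_supercompact
    (K : Type u) [TopologicalSpace K] [CompactSpace K] [TopologicalSpace.MetrizableSpace K]
    (hK : ∃ B : Set (Set K), (∀ s ∈ B, IsClopen s) ∧ IsTopologicalBasis B)
    (D : Type v) [TopologicalSpace D] [DiscreteTopology D] :
    IsHereditarilySupercompact (K × OnePoint D) := by
  intro Z hZ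
  have : SecondCountableTopology K := by
    let := TopologicalSpace.metrizableSpaceMetric K
    infer_instance
  obtain ⟨B, hBc, hB, hnest⟩ := exists_nested_clopen_basis K hK
  exact ⟨rectSubbase B Z, generateFrom_rectSubbase hBc hB hZ,
    fun C hC hcov => rectSubbase_two_cover hBc hnest hZ hC hcov⟩
end

section
/- A compact Hausdorff space X is supercompact if and only if X possesses a binary closed k-network. -/
open Set Topology TopologicalSpace

universe u

/-- A family of sets is *binary* if each of its finite linked subfamilies (any two members
of the subfamily intersect) has nonempty intersection. -/
def IsBinaryFamily {X : Type*} (𝒦 : Set (Set X)) : Prop :=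
  ∀ L ⊆ 𝒦, L.Nonempty → L.Finite →
    (∀ A ∈ L, ∀ B ∈ L, (A ∩ B).Nonempty) → (⋂₀ L).Nonempty

/-- A family `𝒦` of sets in a topological space is a *k-network* if for every open `U` and
every compact `C ⊆ U` there is a finite subfamily `F ⊆ 𝒦` with `C ⊆ ⋃₀ F ⊆ U`. -/
def IsKNetwork {X : Type*} [TopologicalSpace X] (𝒦 : Set (Set X)) : Prop :=
  ∀ U : Set X, IsOpen U → ∀ C ⊆ U, IsCompact C →
    ∃ F ⊆ 𝒦, F.Finite ∧ C ⊆ ⋃₀ F ∧ ⋃₀ F ⊆ U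

theorem Set.Finite.eq_empty_or_eq_pair_of_ncard_le_two {α : Type*} {T : Set α} (hT : T.Finite)
    (h : T.ncard ≤ 2) : T = ∅ ∨ ∃ a b, T = {a, b} := by
  rcases (by omega : T.ncard = 0 ∨ T.ncard = 1 ∨ T.ncard = 2) with h | h | h
  · exact Or.inl ((ncard_eq_zero hT).1 h)
  · obtain ⟨a, rfl⟩ := ncard_eq_one.1 h
    exact Or.inr ⟨a, a, by simp⟩
  · obtain ⟨a, b, -, rfl⟩ := ncard_eq_two.1 h
    exact Or.inr ⟨a, b, rfl⟩

/-- If every cover by members of `S` has a subcover with at most two members, then the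
intersections of complements of members of `S` form a binary family. -/
theorem isBinaryFamily_compl_sUnion {X : Type*} {S : Set (Set X)}
    (hS : ∀ C ⊆ S, ⋃₀ C = univ → ∃ T ⊆ C, T.Finite ∧ T.ncard ≤ 2 ∧ ⋃₀ T = univ) :
    IsBinaryFamily {A | ∃ f ⊆ S, A = (⋃₀ f)ᶜ} := by
  intro L hL hne _ hlink
  by_contra hempty
  have hcover : ⋃₀ {s ∈ S | ∃ A ∈ L, s ⊆ Aᶜ} = univ := by
    refine eq_univ_of_forall fun x => ?_
    have hx : x ∉ ⋂₀ L := fun hx => hempty ⟨x, hx⟩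
    simp only [mem_sInter, not_forall] at hx
    obtain ⟨A, hA, hxA⟩ := hx
    obtain ⟨f, hf, rfl⟩ := hL hA
    obtain ⟨s, hs, hxs⟩ := not_notMem.1 hxA
    exact ⟨s, ⟨hf hs, _, hA, by simpa using subset_sUnion_of_mem hs⟩, hxs⟩
  obtain ⟨T, hTC, hTfin, hTcard, hT⟩ := hS _ (sep_subset _ _) hcover
  rcases hTfin.eq_empty_or_eq_pair_of_ncard_le_two hTcard with rfl | ⟨a, b, rfl⟩
  · obtain ⟨A, hA⟩ := hne
    obtain ⟨x, -⟩ := hlink A hA A hA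
    have hx : x ∈ ⋃₀ (∅ : Set (Set X)) := hT ▸ mem_univ x
    simp at hx
  · obtain ⟨-, A, hA, haA⟩ := hTC (mem_insert a {b})
    obtain ⟨-, B, hB, hbB⟩ := hTC (mem_insert_of_mem a rfl)
    obtain ⟨x, hxA, hxB⟩ := hlink A hA B hB
    have hx : x ∈ ⋃₀ {a, b} := hT ▸ mem_univ x
    rw [sUnion_pair] at hx
    exact hx.elim (fun h => haA h hxA) (fun h => hbB h hxB)

/-- In a compact Hausdorff space, the intersections of complements of members of an open subbase
form a `k`-network. -/
theorem isKNetwork_compl_sUnion {X : Type*} [t : TopologicalSpace X] [CompactSpace X] [T2Space X]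
    {S : Set (Set X)} (hS : t = generateFrom S) :
    IsKNetwork {A | ∃ f ⊆ S, A = (⋃₀ f)ᶜ} := by
  intro U hU C hCU hC
  suffices ∃ F ⊆ {A | ∃ f ⊆ S, A = (⋃₀ f)ᶜ}, F.Finite ∧ C ⊆ ⋃₀ F ∧ Disjoint (⋃₀ F) Uᶜ by
    simpa only [disjoint_compl_right_iff_subset] using this
  refine hU.isClosed_compl.isCompact.induction_on
    (p := fun s => ∃ F ⊆ {A | ∃ f ⊆ S, A = (⋃₀ f)ᶜ}, F.Finite ∧ C ⊆ ⋃₀ F ∧ Disjoint (⋃₀ F) s)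
    ?_ ?_ ?_ ?_
  · refine ⟨{univ}, ?_, finite_singleton _, by simp, by simp⟩
    rintro _ rfl
    exact ⟨∅, empty_subset _, by simp⟩
  · rintro s s' hss ⟨F, hFK, hF, hCF, hd⟩
    exact ⟨F, hFK, hF, hCF, hd.mono_right hss⟩
  · rintro s s' ⟨F, hFK, hF, hCF, hd⟩ ⟨G, hGK, hG, hCG, hd'⟩
    refine ⟨image2 (· ∩ ·) F G, ?_, hF.image2 _ hG, fun x hx => ?_, ?_⟩
    · rintro _ ⟨A, hA, B, hB, rfl⟩
      obtain ⟨f, hf, rfl⟩ := hFK hA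
      obtain ⟨g, hg, rfl⟩ := hGK hB
      exact ⟨f ∪ g, union_subset hf hg, by rw [sUnion_union, compl_union]⟩
    · obtain ⟨A, hA, hxA⟩ := hCF hx
      obtain ⟨B, hB, hxB⟩ := hCG hx
      exact ⟨A ∩ B, mem_image2_of_mem hA hB, hxA, hxB⟩
    · rw [disjoint_left] at hd hd' ⊢
      rintro x ⟨_, ⟨A, hA, B, hB, rfl⟩, hxA, hxB⟩ (hx | hx)
      · exact hd ⟨A, hA, hxA⟩ hx
      · exact hd' ⟨B, hB, hxB⟩ hx
  · intro y hy
    have hbasis := isTopologicalBasis_of_subbasis hS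
    obtain ⟨_, ⟨f, ⟨hf, hfS⟩, rfl⟩, hyf, hfC⟩ := hbasis.exists_subset_of_mem_open
      (show y ∈ Cᶜ from fun h => hy (hCU h)) hC.isClosed.isOpen_compl
    refine ⟨⋂₀ f, mem_nhdsWithin_of_mem_nhds
      ((hbasis.isOpen ⟨f, ⟨hf, hfS⟩, rfl⟩).mem_nhds hyf), compl '' f, ?_, hf.image _, ?_, ?_⟩
    · rintro _ ⟨s, hs, rfl⟩
      exact ⟨{s}, singleton_subset_iff.2 (hfS hs), by simp⟩
    · rw [← compl_sInter]
      exact subset_compl_comm.1 hfC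
    · rw [← compl_sInter]
      exact disjoint_compl_left

/-- The complements of the members of a closed `k`-network in a compact `T₁` space form a subbase
for the topology. -/
theorem IsKNetwork.generateFrom_compl {X : Type*} [t : TopologicalSpace X] [CompactSpace X]
    [T1Space X] {𝒦 : Set (Set X)} (h𝒦 : IsKNetwork 𝒦) (hclosed : ∀ A ∈ 𝒦, IsClosed A) :
    generateFrom (compl '' 𝒦) = t := by
  refine le_antisymm (fun U hU => ?_) (le_generateFrom ?_)
  · let _ : TopologicalSpace X := generateFrom (compl '' 𝒦)
    refine isOpen_iff_mem_nhds.2 fun x hx => ?_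
    obtain ⟨F, hF𝒦, hF, hUF, hFx⟩ := h𝒦 {x}ᶜ (@isOpen_compl_singleton X t _ x) Uᶜ
      (by simpa using hx) (@IsClosed.isCompact X t _ _ (@IsOpen.isClosed_compl X t _ hU))
    have hopen : IsOpen (⋃₀ F)ᶜ := by
      rw [compl_sUnion]
      refine (hF.image _).isOpen_sInter ?_
      rintro _ ⟨A, hA, rfl⟩
      exact isOpen_generateFrom_of_mem ⟨A, hF𝒦 hA, rfl⟩
    exact Filter.mem_of_superset (hopen.mem_nhds fun h => hFx h rfl) (compl_subset_comm.1 hUF)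
  · rintro _ ⟨A, hA, rfl⟩
    exact (hclosed A hA).isOpen_compl

/-- In a compact space, a binary family of closed sets satisfies the binary condition for infinite
linked subfamilies too. -/
theorem IsBinaryFamily.sInter_nonempty {X : Type*} [TopologicalSpace X] [CompactSpace X]
    {𝒦 L : Set (Set X)} (h𝒦 : IsBinaryFamily 𝒦) (hclosed : ∀ A ∈ 𝒦, IsClosed A) (hL : L ⊆ 𝒦)
    (hne : L.Nonempty) (hlink : ∀ A ∈ L, ∀ B ∈ L, (A ∩ B).Nonempty) : (⋂₀ L).Nonempty := by
  obtain ⟨A₀, hA₀⟩ := hne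
  have hfip := isCompact_univ.inter_iInter_nonempty (fun A : L => (A : Set X))
    (fun A => hclosed A (hL A.2)) fun u => ?_
  · rwa [univ_inter, ← sInter_eq_iInter] at hfip
  · have hsub : insert A₀ (Subtype.val '' (u : Set L)) ⊆ L :=
      insert_subset hA₀ (Subtype.coe_image_subset _ _)
    obtain ⟨x, hx⟩ := h𝒦 _ (hsub.trans hL) (insert_nonempty _ _)
      ((u.finite_toSet.image _).insert _) fun A hA B hB => hlink A (hsub hA) B (hsub hB)
    exact ⟨x, mem_univ x, mem_iInter₂.2 fun A hA => hx _ (mem_insert_of_mem _ ⟨A, hA, rfl⟩)⟩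

/-- In a compact space, every cover by complements of members of a binary family of closed sets
has a subcover with at most two members. -/
theorem IsBinaryFamily.exists_subcover_ncard_le_two {X : Type*} [TopologicalSpace X]
    [CompactSpace X] {𝒦 C : Set (Set X)} (h𝒦 : IsBinaryFamily 𝒦)
    (hclosed : ∀ A ∈ 𝒦, IsClosed A) (hC : C ⊆ compl '' 𝒦) (hcover : ⋃₀ C = univ) :
    ∃ T ⊆ C, T.Finite ∧ T.ncard ≤ 2 ∧ ⋃₀ T = univ := by
  rcases C.eq_empty_or_nonempty with rfl | hne
  · exact ⟨∅, subset_rfl, finite_empty, by simp, hcover⟩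
  by_contra! hno
  have hsub : compl '' C ⊆ 𝒦 := by
    rintro _ ⟨s, hs, rfl⟩
    obtain ⟨A, hA, rfl⟩ := hC hs
    simpa using hA
  obtain ⟨x, hx⟩ := h𝒦.sInter_nonempty hclosed hsub (hne.image _) (by
    rintro _ ⟨a, ha, rfl⟩ _ ⟨b, hb, rfl⟩
    have hab := hno {a, b} (pair_subset ha hb) (toFinite _) ((ncard_insert_le a {b}).trans (by simp))
    rwa [sUnion_pair, ← nonempty_compl, compl_union] at hab)
  rw [← compl_sUnion, hcover] at hx
  exact hx (mem_univ x)

/-- A compact Hausdorff space is supercompact if and only if it possesses a binary closed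
k-network. -/
theorem supercompact_iff_exists_binary_closed_kNetwork
    (X : Type u) [TopologicalSpace X] [CompactSpace X] [T2Space X] :
    IsSupercompact X ↔
      ∃ 𝒦 : Set (Set X), (∀ A ∈ 𝒦, IsClosed A) ∧ IsBinaryFamily 𝒦 ∧ IsKNetwork 𝒦 := by
  constructor
  · rintro ⟨S, hgen, hS⟩
    refine ⟨{A | ∃ f ⊆ S, A = (⋃₀ f)ᶜ}, ?_, isBinaryFamily_compl_sUnion hS,
      isKNetwork_compl_sUnion hgen.symm⟩
    rintro _ ⟨f, hf, rfl⟩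
    refine (isOpen_sUnion fun s hs => ?_).isClosed_compl
    rw [← hgen]
    exact isOpen_generateFrom_of_mem (hf hs)
  · rintro ⟨𝒦, hclosed, hbin, hnet⟩
    exact ⟨compl '' 𝒦, hnet.generateFrom_compl hclosed,
      fun C hC hcover => hbin.exists_subcover_ncard_le_two hclosed hC hcover⟩
end

section
/- Assume ω₁ < 𝔭. Then every hereditarily supercompact (Hausdorff) space is sub-hereditarily separable, i.e., every separable subspace of it is hereditarily separable. -/
open Set Topology TopologicalSpace

universe u

/-- The pseudo-intersection number `𝔭`: the smallest cardinality of a family `B` of infinite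
subsets of `ℕ` all of whose finite intersections are infinite, but which admits no infinite
pseudo-intersection (an infinite `I ⊆ ℕ` with `I \ s` finite for every `s ∈ B`). -/
noncomputable def pseudoIntersectionNumber : Cardinal :=
  sInf {c : Cardinal | ∃ B : Set (Set ℕ), Cardinal.mk B = c ∧
    (∀ s ∈ B, s.Infinite) ∧
    (∀ F ⊆ B, F.Finite → (⋂₀ F).Infinite) ∧
    ¬ ∃ I : Set ℕ, I.Infinite ∧ ∀ s ∈ B, (I \ s).Finite}

open Filter

/-- If every element of an uncountable set is related to some element of a countable type, then
uncountably many of them are related to the same one. -/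
theorem exists_not_countable_setOf_rel {ι β : Type*} [Countable β] {I : Set ι}
    (hI : ¬ I.Countable) (P : ι → β → Prop) (h : ∀ i ∈ I, ∃ b, P i b) :
    ∃ b, ¬ {i ∈ I | P i b}.Countable := by
  by_contra! hc
  refine hI ((countable_iUnion hc).mono fun i hi => ?_)
  obtain ⟨b, hb⟩ := h i hi
  exact mem_iUnion.2 ⟨b, hi, hb⟩

section Binary

variable {Z : Type*} {S : Set (Set Z)}

/-- The sets that are intersections of complements of members of `S`. -/
def IsSubbaseConvex (S : Set (Set Z)) (C : Set Z) : Prop :=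
  ∃ T ⊆ S, C = (⋃₀ T)ᶜ

theorem IsSubbaseConvex.inter {C C' : Set Z} (h : IsSubbaseConvex S C)
    (h' : IsSubbaseConvex S C') : IsSubbaseConvex S (C ∩ C') := by
  obtain ⟨T, hT, rfl⟩ := h
  obtain ⟨T', hT', rfl⟩ := h'
  exact ⟨T ∪ T', union_subset hT hT', by rw [sUnion_union, compl_union]⟩

theorem IsSubbaseConvex.isClosed [TopologicalSpace Z] (hS : ∀ s ∈ S, IsOpen s) {C : Set Z}
    (h : IsSubbaseConvex S C) : IsClosed C := by
  obtain ⟨T, hT, rfl⟩ := h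
  exact (isOpen_sUnion fun s hs => hS s (hT hs)).isClosed_compl

/-- Helly property of the convex sets of a binary subbase. -/
theorem IsSubbaseConvex.nonempty_sInter
    (hS : ∀ C ⊆ S, ⋃₀ C = univ → ∃ T ⊆ C, T.Finite ∧ T.ncard ≤ 2 ∧ ⋃₀ T = univ)
    {F : Set (Set Z)} (hF : ∀ C ∈ F, IsSubbaseConvex S C) (hne : F.Nonempty)
    (hlink : ∀ C ∈ F, ∀ C' ∈ F, (C ∩ C').Nonempty) : (⋂₀ F).Nonempty := by
  choose! T hT hC using hF
  by_contra hemp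
  have hcover : ⋃₀ (⋃ C ∈ F, T C) = univ := by
    refine eq_univ_of_forall fun x => ?_
    by_contra hx
    refine hemp ⟨x, fun C hCF => ?_⟩
    rw [hC C hCF]
    rintro ⟨s, hs, hxs⟩
    exact hx ⟨s, mem_biUnion hCF hs, hxs⟩
  obtain ⟨P, hP, hfin, hcard, hPu⟩ := hS _ (iUnion₂_subset hT) hcover
  have key : ∀ s ∈ P, ∀ t ∈ P, s ∪ t ≠ univ := by
    intro s hs t ht hst
    obtain ⟨C, hCF, hsC⟩ := mem_iUnion₂.1 (hP hs)
    obtain ⟨C', hCF', htC⟩ := mem_iUnion₂.1 (hP ht)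
    obtain ⟨x, hx, hx'⟩ := hlink C hCF C' hCF'
    rw [hC C hCF] at hx
    rw [hC C' hCF'] at hx'
    have : x ∈ s ∪ t := hst ▸ mem_univ x
    exact this.elim (fun h => hx ⟨s, hsC, h⟩) fun h => hx' ⟨t, htC, h⟩
  obtain ⟨C, hCF⟩ := hne
  obtain ⟨x, -, -⟩ := hlink C hCF C hCF
  obtain ⟨s, hs, -⟩ : x ∈ ⋃₀ P := hPu ▸ mem_univ x
  by_cases hPs : ∃ t ∈ P, t ≠ s
  · obtain ⟨t, ht, hts⟩ := hPs
    have hsub : {s, t} ⊆ P := by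
      rintro u (rfl | rfl) <;> assumption
    have : {s, t} = P :=
      Set.eq_of_subset_of_ncard_le hsub (by rwa [Set.ncard_pair hts.symm]) hfin
    exact key s hs t ht (by rw [← hPu, ← this, sUnion_pair])
  · push Not at hPs
    have : P = {s} := subset_antisymm hPs (singleton_subset_iff.2 hs)
    exact key s hs s hs (by rw [← hPu, this, union_self, sUnion_singleton])

/-- A closed set inside an open subset of a compact space can be covered by finitely many convex
sets contained in the open set. -/
theorem exists_finite_cover_isSubbaseConvex [t : TopologicalSpace Z] [CompactSpace Z]
    (hS : generateFrom S = t) {A O : Set Z} (hA : IsClosed A) (hO : IsOpen O) (hAO : A ⊆ O) :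
    ∃ H : Set (Set Z), H.Finite ∧ (∀ C ∈ H, IsSubbaseConvex S C) ∧ A ⊆ ⋃₀ H ∧ ⋃₀ H ⊆ O := by
  suffices ∃ H : Set (Set Z), H.Finite ∧ (∀ C ∈ H, IsSubbaseConvex S C) ∧ A ⊆ ⋃₀ H ∧
      Disjoint (⋃₀ H) Oᶜ by
    simpa only [disjoint_compl_right_iff_subset] using this
  refine hO.isClosed_compl.isCompact.induction_on
    (p := fun s => ∃ H : Set (Set Z), H.Finite ∧ (∀ C ∈ H, IsSubbaseConvex S C) ∧ A ⊆ ⋃₀ H ∧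
      Disjoint (⋃₀ H) s) ?_ ?_ ?_ ?_
  · exact ⟨{univ}, finite_singleton _, by
      rintro _ rfl
      exact ⟨∅, empty_subset _, by simp⟩, by simp, disjoint_bot_right⟩
  · rintro s s' hss ⟨H, h1, h2, h3, h4⟩
    exact ⟨H, h1, h2, h3, h4.mono_right hss⟩
  · rintro s s' ⟨H, h1, h2, h3, h4⟩ ⟨H', h1', h2', h3', h4'⟩
    refine ⟨image2 (· ∩ ·) H H', h1.image2 _ h1', ?_, ?_, ?_⟩
    · rintro _ ⟨C, hC, C', hC', rfl⟩
      exact (h2 C hC).inter (h2' C' hC')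
    · intro x hx
      obtain ⟨C, hC, hxC⟩ := h3 hx
      obtain ⟨C', hC', hxC'⟩ := h3' hx
      exact ⟨_, mem_image2_of_mem hC hC', hxC, hxC'⟩
    · rw [Set.disjoint_left] at *
      rintro x ⟨_, ⟨C, hC, C', hC', rfl⟩, hx, hx'⟩ (h | h)
      · exact h4 ⟨C, hC, hx⟩ h
      · exact h4' ⟨C', hC', hx'⟩ h
  · intro b hb
    obtain ⟨_, ⟨T, ⟨hTfin, hTS⟩, rfl⟩, hbT, hTA⟩ :=
      (isTopologicalBasis_of_subbasis hS.symm).exists_subset_of_mem_open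
        (show b ∈ Aᶜ from fun h => hb (hAO h)) hA.isOpen_compl
    refine ⟨⋂₀ T, mem_nhdsWithin_of_mem_nhds (hTfin.isOpen_sInter (fun s hs => ?_) |>.mem_nhds hbT),
      compl '' T, hTfin.image _, ?_, ?_, ?_⟩
    · rw [← hS]
      exact isOpen_generateFrom_of_mem (hTS hs)
    · rintro _ ⟨s, hs, rfl⟩
      exact ⟨{s}, singleton_subset_iff.2 (hTS hs), by rw [sUnion_singleton]⟩
    · rw [← compl_sInter]
      exact subset_compl_comm.1 hTA
    · rw [← compl_sInter]
      exact disjoint_compl_left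

end Binary

theorem IsSupercompact.compactSpace {Z : Type*} [t : TopologicalSpace Z] (h : IsSupercompact Z) :
    CompactSpace Z := by
  obtain ⟨S, hS, hb⟩ := h
  refine ⟨isCompact_generateFrom hS.symm fun P hP hc => ?_⟩
  obtain ⟨T, hT, hfin, -, hu⟩ := hb P hP (univ_subset_iff.1 hc)
  exact ⟨T, hT, hfin, hu.ge⟩

theorem mapClusterPt_cofinite_of_notMem_range {Z κ : Type*} [TopologicalSpace Z] [T1Space Z]
    {d : κ → Z} {q : Z} (hd : q ∈ closure (range d)) (hq : q ∉ range d) :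
    MapClusterPt q cofinite d := by
  rw [mapClusterPt_iff_frequently]
  intro s hs
  rw [frequently_cofinite_iff_infinite]
  intro hfin
  have hnhds : s \ d '' {k | d k ∈ s} ∈ 𝓝 q :=
    inter_mem hs ((hfin.image d).isClosed.isOpen_compl.mem_nhds
      fun h => hq (image_subset_range _ _ h))
  obtain ⟨_, ⟨h1, h2⟩, k, rfl⟩ := mem_closure_iff_nhds.1 hd _ hnhds
  exact h2 ⟨k, h1, rfl⟩

/-- An uncountable family of points of a compact space has a condensation point. -/
theorem exists_condensation_point {Z ι : Type*} [TopologicalSpace Z] [CompactSpace Z]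
    (y : ι → Z) {I : Set ι} (hI : ¬ I.Countable) :
    ∃ p, ∀ O ∈ 𝓝 p, ¬ {α ∈ I | y α ∈ O}.Countable := by
  by_contra! h
  refine hI ?_
  suffices {α ∈ I | y α ∈ (univ : Set Z)}.Countable by simpa using this
  refine isCompact_univ.induction_on (p := fun s => {α ∈ I | y α ∈ s}.Countable) (by simp) ?_ ?_ ?_
  · refine fun s t hst ht => ht.mono ?_
    rintro α ⟨hα, h⟩
    exact ⟨hα, hst h⟩
  · refine fun s t hs ht => (hs.union ht).mono ?_
    rintro α ⟨hα, h | h⟩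
    exacts [.inl ⟨hα, h⟩, .inr ⟨hα, h⟩]
  · exact fun x _ => by simpa only [nhdsWithin_univ] using h x

/-- In a supercompact space with a countable dense family of points, there is no uncountable family
of continuous functions that is point-countable at the cluster points of the dense family and each
of whose members is large infinitely often. -/
theorem IsSupercompact.false_of_pointCountable {Z κ ι : Type*} [TopologicalSpace Z] [T2Space Z]
    (hZ : IsSupercompact Z) [Countable κ] [Uncountable ι] {d : κ → Z} (hd : DenseRange d)
    (f : ι → C(Z, ℝ)) (hf : ∀ q, MapClusterPt q cofinite d → {α | 0 < f α q}.Countable)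
    (hfd : ∀ α, {k | 1 / 2 < f α (d k)}.Infinite) : False := by
  have := hZ.compactSpace
  obtain ⟨S, hS, hbin⟩ := hZ
  have hSo : ∀ s ∈ S, IsOpen s := fun s hs => by
    rw [← hS]
    exact isOpen_generateFrom_of_mem hs
  have hC : ∀ α, ∃ C, IsSubbaseConvex S C ∧ (∀ x ∈ C, 1 / 4 < f α x) ∧
      ∃ y ∈ C, MapClusterPt y cofinite d ∧ ∃ e, d e ∈ C := by
    intro α
    obtain ⟨H, hHfin, hHc, hAH, hHO⟩ := exists_finite_cover_isSubbaseConvex hS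
      (A := {x | 1 / 2 ≤ f α x}) (O := {x | 1 / 4 < f α x})
      (isClosed_le continuous_const (f α).continuous)
      (isOpen_lt continuous_const (f α).continuous)
      (fun x (hx : 1 / 2 ≤ f α x) => show 1 / 4 < f α x by linarith)
    obtain ⟨C, hCH, hCinf⟩ : ∃ C ∈ H, {k | d k ∈ C}.Infinite := by
      by_contra! hcon
      refine hfd α ((hHfin.biUnion hcon).subset fun k (hk : 1 / 2 < f α (d k)) => ?_)
      obtain ⟨C, hCH, hk⟩ := hAH (show 1 / 2 ≤ f α (d k) from hk.le)
      exact mem_biUnion hCH hk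
    obtain ⟨y, hyC, hy⟩ := ((hHc C hCH).isClosed hSo).isCompact.exists_mapClusterPt_of_frequently
      (frequently_cofinite_iff_infinite.2 hCinf)
    exact ⟨C, hHc C hCH, fun x hx => hHO ⟨C, hCH, hx⟩, y, hyC, hy, hCinf.nonempty⟩
  choose C hCc hCf y hyC hy e he using hC
  have hG : ∀ α, ∃ H : Set (Set Z), H.Finite ∧ (∀ G ∈ H, IsSubbaseConvex S G) ∧
      (∀ x, f α x ≤ 1 / 8 → ∃ G ∈ H, x ∈ G) ∧ ∀ G ∈ H, ∀ x ∈ G, x ∉ C α := by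
    intro α
    obtain ⟨H, hHfin, hHc, hAH, hHO⟩ := exists_finite_cover_isSubbaseConvex hS
      (A := {x | f α x ≤ 1 / 8}) (O := {x | f α x < 1 / 4})
      (isClosed_le (f α).continuous continuous_const)
      (isOpen_lt (f α).continuous continuous_const)
      (fun x (hx : f α x ≤ 1 / 8) => show f α x < 1 / 4 by linarith)
    refine ⟨H, hHfin, hHc, fun x hx => hAH hx, fun G hG x hx hxC => ?_⟩
    have h1 : f α x < 1 / 4 := hHO ⟨G, hG, hx⟩
    linarith [hCf α x hxC]
  obtain ⟨k₀, hI⟩ := exists_not_countable_setOf_rel (I := (univ : Set ι)) not_countable_univ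
    (fun α k => e α = k) fun α _ => ⟨_, rfl⟩
  set I : Set ι := {α ∈ univ | e α = k₀} with hIdef
  have hIe : ∀ α ∈ I, d k₀ ∈ C α := fun α hα => hα.2 ▸ he α
  have hγ : ∃ γ ∈ I, ∀ m : Finset κ,
      ¬ {α ∈ I | (∀ k ∈ m, d k ∈ C α ↔ d k ∈ C γ) ∧ f γ (y α) ≤ 1 / 8}.Countable := by
    by_contra! hcon
    classical
    obtain ⟨⟨m, s⟩, hI'⟩ := exists_not_countable_setOf_rel hI
      (fun γ (ms : Finset κ × Finset κ) => (∀ k ∈ ms.1, k ∈ ms.2 ↔ d k ∈ C γ) ∧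
        {α ∈ I | (∀ k ∈ ms.1, d k ∈ C α ↔ d k ∈ C γ) ∧ f γ (y α) ≤ 1 / 8}.Countable) (by
        intro γ hγ
        obtain ⟨m, hm⟩ := hcon γ hγ
        exact ⟨(m, m.filter fun k => d k ∈ C γ), by simp +contextual, hm⟩)
    obtain ⟨p, hp⟩ := exists_condensation_point y hI'
    have hpcl : MapClusterPt p cofinite d := by
      rw [mapClusterPt_iff_frequently]
      intro O hO
      obtain ⟨O', hO'O, hO', hpO'⟩ := mem_nhds_iff.1 hO
      obtain ⟨α, -, hα⟩ : {α ∈ _ | y α ∈ O'}.Nonempty := by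
        rw [nonempty_iff_ne_empty]
        intro h0
        exact hp O' (hO'.mem_nhds hpO') (h0 ▸ countable_empty)
      exact (mapClusterPt_iff_frequently.1 (hy α) O' (hO'.mem_nhds hα)).mono fun k hk => hO'O hk
    refine hI' ((hf p hpcl).mono fun γ hγ => ?_)
    by_contra hneg
    have hlt : f γ p < 1 / 8 := by
      have : ¬ (0 < f γ p) := hneg
      linarith
    refine hp {x | f γ x < 1 / 8}
      ((isOpen_lt (f γ).continuous continuous_const).mem_nhds hlt) (hγ.2.2.mono ?_)
    rintro α ⟨⟨hαI, hαs, -⟩, hα⟩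
    exact ⟨hαI, fun k hk => (hαs k hk).symm.trans (hγ.2.1 k hk), le_of_lt hα⟩
  obtain ⟨γ, hγI, hγ⟩ := hγ
  obtain ⟨H, hHfin, hHc, hHcov, hHC⟩ := hG γ
  obtain ⟨G, hGH, hG⟩ : ∃ G ∈ H, ∀ m : Finset κ,
      ¬ {α ∈ I | (∀ k ∈ m, d k ∈ C α ↔ d k ∈ C γ) ∧ y α ∈ G}.Countable := by
    by_contra! hcon
    choose! m hm using hcon
    classical
    refine hγ (hHfin.toFinset.biUnion m) ((hHfin.countable.biUnion hm).mono ?_)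
    rintro α ⟨hαI, hαm, hα⟩
    obtain ⟨G, hGH, hyG⟩ := hHcov _ hα
    refine mem_biUnion hGH ⟨hαI, fun k hk => hαm k ?_, hyG⟩
    exact Finset.mem_biUnion.2 ⟨G, hHfin.mem_toFinset.2 hGH, hk⟩
  set B : Set ι := {α ∈ I | y α ∈ G} with hB
  have hBunc : ¬ B.Countable := by simpa using hG ∅
  obtain ⟨q, hq⟩ : (⋂₀ insert G (C '' B)).Nonempty := by
    refine IsSubbaseConvex.nonempty_sInter hbin ?_ (insert_nonempty _ _) ?_
    · rintro _ (rfl | ⟨α, -, rfl⟩)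
      exacts [hHc _ hGH, hCc α]
    · rintro _ (rfl | ⟨α, hα, rfl⟩) _ (rfl | ⟨β, hβ, rfl⟩)
      · obtain ⟨α, hα⟩ : B.Nonempty := by
          rw [nonempty_iff_ne_empty]
          exact fun h0 => hBunc (h0 ▸ countable_empty)
        exact ⟨y α, hα.2, hα.2⟩
      · exact ⟨y β, hβ.2, hyC β⟩
      · exact ⟨y α, hyC α, hα.2⟩
      · exact ⟨d k₀, hIe α hα.1, hIe β hβ.1⟩
  have hqG : q ∈ G := hq G (mem_insert _ _)
  have hqC : ∀ α ∈ B, q ∈ C α := fun α hα => hq _ (mem_insert_of_mem _ (mem_image_of_mem C hα))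
  by_cases hqd : q ∈ range d
  · obtain ⟨k, rfl⟩ := hqd
    obtain ⟨α, hαI, hαk, hαG⟩ :
        {α ∈ I | (∀ j ∈ ({k} : Finset κ), d j ∈ C α ↔ d j ∈ C γ) ∧ y α ∈ G}.Nonempty := by
      rw [nonempty_iff_ne_empty]
      exact fun h0 => hG {k} (h0 ▸ countable_empty)
    exact hHC G hGH _ hqG ((hαk k (Finset.mem_singleton_self k)).1 (hqC α ⟨hαI, hαG⟩))
  · refine hBunc ((hf q (mapClusterPt_cofinite_of_notMem_range (hd q) hqd)).mono fun α hα => ?_)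
    have := hCf α q (hqC α hα)
    exact show 0 < f α q by linarith

open Cardinal

/-- Below `𝔭`, families of subsets of a countably infinite set with infinite finite intersections
have pseudo-intersections. -/
theorem exists_infinite_pseudoIntersection {κ : Cardinal.{0}} (hκ : κ < pseudoIntersectionNumber)
    {J Q : Type} [Denumerable Q] (hJ : #J ≤ κ) (t : J → Set Q)
    (ht : ∀ F : Finset J, (⋂ j ∈ F, t j).Infinite) :
    ∃ I : Set Q, I.Infinite ∧ ∀ j, (I \ t j).Finite := by
  let e : Q ≃ ℕ := Denumerable.eqv Q
  have hlt : #(range fun j => e '' t j) < pseudoIntersectionNumber :=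
    (mk_range_le.trans hJ).trans_lt hκ
  have hnot := notMem_of_lt_csInf' hlt
  simp only [mem_ofPred_eq, not_exists, not_and, not_forall, not_not] at hnot
  obtain ⟨I, hI, hIt⟩ := hnot _ rfl (by
      rintro _ ⟨j, rfl⟩
      have := ht {j}
      simp only [Finset.mem_singleton, iInter_iInter_eq_left] at this
      exact this.image e.injective.injOn) (by
      intro F hF hfin
      classical
      obtain ⟨G, -, hGfin, rfl⟩ := (Set.exists_subset_image_finite_and (s := univ)
        (p := fun t' => t' = F) (f := fun j => e '' t j)).1 ⟨F, by simpa using hF, hfin, rfl⟩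
      refine ((ht hGfin.toFinset).image e.injective.injOn).mono ?_
      rintro _ ⟨x, hx, rfl⟩ _ ⟨j, hj, rfl⟩
      exact mem_image_of_mem e (mem_iInter₂.1 hx j (hGfin.mem_toFinset.2 hj)))
  refine ⟨e ⁻¹' I, hI.preimage (by simp), fun j => ?_⟩
  have := (hIt _ (mem_range_self j)).preimage (f := e) e.injective.injOn
  rwa [preimage_sdiff, e.preimage_image] at this

/-- Below `𝔭`, if every `V α` has infinite intersection with each finite intersection of the `U i`,
then some set meets all the `V α` in infinite sets and is almost contained in all the `U i`. -/
theorem exists_almost_subset_of_inter_infinite {κ : Cardinal.{0}}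
    (hκ : κ < pseudoIntersectionNumber) (hω : ℵ₀ ≤ κ) {J L : Type} [Nonempty L]
    (hJ : #J ≤ κ) (hL : #L ≤ κ) (U : J → Set ℕ) (V : L → Set ℕ)
    (h : ∀ (F : Finset J) (α : L), (V α ∩ ⋂ i ∈ F, U i).Infinite) :
    ∃ E : Set ℕ, (∀ i, (E \ U i).Finite) ∧ ∀ α, (E ∩ V α).Infinite := by
  classical
  let t : J ⊕ L ⊕ ℕ → Set (Finset ℕ) := Sum.elim (fun i => {s | ∀ k ∈ s, k ∈ U i})
    (Sum.elim (fun α => {s | ∃ k ∈ s, k ∈ V α}) fun N => {s | ∀ k ∈ s, N ≤ k})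
  have hcard : #(J ⊕ L ⊕ ℕ) ≤ κ := by
    simp only [mk_sum, lift_uzero, mk_nat]
    exact add_le_of_le hω hJ (add_le_of_le hω hL hω)
  have hne : ∀ (F : Finset (J ⊕ L ⊕ ℕ)) (N : ℕ),
      ∃ s ∈ ⋂ j ∈ F, t j, s.Nonempty ∧ ∀ k ∈ s, N ≤ k := by
    intro F N
    let M := N + F.toRight.toRight.sup id
    have hk : ∀ α, ∃ k, k ∈ V α ∩ ⋂ i ∈ F.toLeft, U i ∧ M < k := fun α =>
      (h F.toLeft α).exists_gt M
    choose k hk hMk using hk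
    obtain ⟨α₀⟩ := ‹Nonempty L›
    refine ⟨(insert α₀ F.toRight.toLeft).image k, ?_, by simp, ?_⟩
    · refine mem_iInter₂.2 ?_
      rintro (i | α | n) hj
      · intro m hm
        obtain ⟨β, -, rfl⟩ := Finset.mem_image.1 hm
        exact mem_iInter₂.1 (hk β).2 i (Finset.mem_toLeft.2 hj)
      · exact ⟨k α, Finset.mem_image_of_mem _ (Finset.mem_insert_of_mem
          (Finset.mem_toLeft.2 (Finset.mem_toRight.2 hj))), (hk α).1⟩
      · intro m hm
        obtain ⟨β, -, rfl⟩ := Finset.mem_image.1 hm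
        have : n ≤ F.toRight.toRight.sup id := Finset.le_sup (f := id)
          (Finset.mem_toRight.2 (Finset.mem_toRight.2 hj))
        have := hMk β
        omega
    · intro m hm
      obtain ⟨β, -, rfl⟩ := Finset.mem_image.1 hm
      have := hMk β
      omega
  obtain ⟨I, hI, hIt⟩ := exists_infinite_pseudoIntersection hκ hcard t (by
    intro F hfin
    obtain ⟨s, hs, ⟨k, hk⟩, hsN⟩ := hne F (hfin.toFinset.sup (fun s => s.sup id) + 1)
    have h1 : s.sup id ≤ hfin.toFinset.sup (fun s => s.sup id) :=
      Finset.le_sup (f := fun s : Finset ℕ => s.sup id) (hfin.mem_toFinset.2 hs)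
    have h2 : k ≤ s.sup id := Finset.le_sup (f := id) hk
    have h3 := hsN k hk
    omega)
  refine ⟨⋃ s ∈ I, (s : Set ℕ), fun i => ?_, fun α hfin => ?_⟩
  · refine ((hIt (Sum.inl i)).biUnion fun s _ => s.finite_toSet).subset ?_
    rintro k ⟨hk, hkU⟩
    obtain ⟨s, hs, hks⟩ := mem_iUnion₂.1 hk
    exact mem_biUnion ⟨hs, fun hst => hkU (hst k hks)⟩ hks
  · obtain ⟨N, hN⟩ := hfin.bddAbove
    obtain ⟨s, hsI, hs⟩ := (hI.sdiff ((hIt (Sum.inr (Sum.inl α))).union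
      (hIt (Sum.inr (Sum.inr (N + 1)))))).nonempty
    simp only [mem_union, Set.mem_sdiff, not_or, not_and, not_not] at hs
    obtain ⟨k, hks, hkV⟩ := hs.1 hsI
    have h1 : N + 1 ≤ k := hs.2 hsI k hks
    have h2 : k ≤ N := hN ⟨mem_biUnion hsI hks, hkV⟩
    omega

theorem IsHereditarilySupercompact.compactSpace {X : Type*} [TopologicalSpace X]
    (hX : IsHereditarilySupercompact X) : CompactSpace X :=
  ⟨isCompact_iff_compactSpace.2 (hX univ isClosed_univ).compactSpace⟩

/-- If `q` can be approximated by points of a compact set `K` with respect to finitely many of the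
functions `f α` at a time, then some point of `K` is not distinguished from `q` by the `f α`. -/
theorem IsCompact.exists_forall_eq_of_approx {X ι : Type*} [TopologicalSpace X] [T2Space X]
    {K : Set X} (hK : IsCompact K) (f : ι → C(X, ℝ)) (q : X)
    (h : ∀ (a : Finset ι) (n : ℕ), ∃ k ∈ K, ∀ α ∈ a, |f α q - f α k| ≤ 2 / ((n : ℝ) + 1)) :
    ∃ k ∈ K, ∀ α, f α q = f α k := by
  classical
  let P : Finset ι × ℕ → Set X := fun an =>
    K ∩ ⋂ α ∈ an.1, {k | |f α q - f α k| ≤ 2 / ((an.2 : ℝ) + 1)}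
  have hcl : ∀ an : Finset ι × ℕ, IsClosed (⋂ α ∈ an.1,
      {k | |f α q - f α k| ≤ 2 / ((an.2 : ℝ) + 1)}) := fun an =>
    isClosed_biInter fun α _ =>
      isClosed_le (continuous_const.sub (f α).continuous).abs continuous_const
  obtain ⟨k, hk⟩ := IsCompact.nonempty_iInter_of_directed_nonempty_isCompact_isClosed P (by
      rintro ⟨a, n⟩ ⟨b, m⟩
      have hmono : ∀ i : ℕ, i ≤ max n m →
          2 / (((max n m : ℕ) : ℝ) + 1) ≤ 2 / ((i : ℝ) + 1) := by
        intro i hi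
        have : (i : ℝ) ≤ (max n m : ℕ) := Nat.cast_le.2 hi
        gcongr
      refine ⟨(a ∪ b, max n m), ?_, ?_⟩ <;> rintro k ⟨hkK, hk⟩ <;>
        refine ⟨hkK, mem_iInter₂.2 fun α hα => ?_⟩
      · exact (mem_iInter₂.1 hk α (Finset.mem_union_left _ hα)).trans (hmono _ (le_max_left _ _))
      · exact (mem_iInter₂.1 hk α (Finset.mem_union_right _ hα)).trans (hmono _ (le_max_right _ _)))
    (fun ⟨a, n⟩ => by
      obtain ⟨k, hkK, hk⟩ := h a n
      exact ⟨k, hkK, mem_iInter₂.2 hk⟩)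
    (fun an => hK.inter_right (hcl an)) fun an => hK.isClosed.inter (hcl an)
  rw [mem_iInter] at hk
  refine ⟨k, (hk (∅, 0)).1, fun α => ?_⟩
  have hle : ∀ n : ℕ, |f α q - f α k| ≤ 2 / ((n : ℝ) + 1) := fun n =>
    mem_iInter₂.1 (hk ({α}, n)).2 α (Finset.mem_singleton_self α)
  have hlim : Tendsto (fun n : ℕ => 2 / ((n : ℝ) + 1)) atTop (𝓝 0) :=
    tendsto_const_nhds.div_atTop (tendsto_atTop_add_const_right _ _ tendsto_natCast_atTop_atTop)
  have := ge_of_tendsto' hlim hle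
  exact sub_eq_zero.1 (abs_eq_zero.1 (le_antisymm this (abs_nonneg _)))

theorem IsHereditarilySupercompact.false_of_mapClusterPt
    {X : Type*} [TopologicalSpace X] [T2Space X] (hX : IsHereditarilySupercompact X)
    {ι : Type} [Uncountable ι] (hι : #ι < pseudoIntersectionNumber) (d : ℕ → X) (x : ι → X)
    (hx : ∀ α, MapClusterPt (x α) cofinite d) (f : ι → C(X, ℝ)) (hfx : ∀ α, f α (x α) = 1)
    (hf : ∀ q ∈ closure (range x), {α | 0 < f α q}.Countable) : False := by
  have := hX.compactSpace
  let O : Finset ι × ℕ → Set X := fun an =>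
    {q | ∃ k ∈ closure (range x), ∀ α ∈ an.1, |f α q - f α k| < 1 / ((an.2 : ℝ) + 1)}
  have hO : ∀ an α, O an ∈ 𝓝 (x α) := by
    intro an α
    have : ∀ᶠ q in 𝓝 (x α), ∀ β ∈ an.1, |f β q - f β (x α)| < 1 / ((an.2 : ℝ) + 1) := by
      rw [eventually_all_finset]
      intro β _
      refine ((f β).continuous.sub continuous_const).abs.continuousAt.eventually_lt
        continuousAt_const ?_
      simpa using Nat.cast_add_one_pos an.2
    filter_upwards [this] with q hq
    exact ⟨x α, subset_closure (mem_range_self α), hq⟩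
  obtain ⟨E, hEO, hEf⟩ := exists_almost_subset_of_inter_infinite (J := Finset ι × ℕ) hι
    (aleph0_le_mk ι) (by simp) le_rfl (fun an => d ⁻¹' O an)
    (fun α => {k | 1 / 2 < f α (d k)}) (by
      intro F α
      have h1 : ∀ᶠ q in 𝓝 (x α), 1 / 2 < f α q :=
        continuousAt_const.eventually_lt (f α).continuous.continuousAt (by rw [hfx]; norm_num)
      have h2 : ∀ᶠ q in 𝓝 (x α), ∀ an ∈ F, q ∈ O an := by
        rw [eventually_all_finset]
        exact fun an _ => hO an α
      refine (frequently_cofinite_iff_infinite.1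
        (mapClusterPt_iff_frequently.1 (hx α) _ (h1.and h2))).mono ?_
      rintro k ⟨hk1, hk2⟩
      exact ⟨hk1, mem_iInter₂.2 hk2⟩)
  let Z : Set X := closure (d '' E)
  let d' : E → Z := fun k => ⟨d k, subset_closure (mem_image_of_mem d k.2)⟩
  refine (hX Z isClosed_closure).false_of_pointCountable (κ := E) (d := d') ?_
    (fun α => (f α).comp ⟨Subtype.val, continuous_subtype_val⟩) ?_ ?_
  · intro z
    rw [closure_subtype, ← range_comp]
    have : range (Subtype.val ∘ d') = d '' E := by
      ext
      simp [d']
    rw [this]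
    exact z.2
  · intro q hq
    obtain ⟨k, hk, hqk⟩ := isClosed_closure.isCompact.exists_forall_eq_of_approx
      (K := closure (range x)) f q.1 (by
        intro a n
        have h1 : ∀ᶠ z : Z in 𝓝 q, ∀ α ∈ a, |f α q - f α z| < 1 / ((n : ℝ) + 1) := by
          rw [eventually_all_finset]
          intro α _
          refine (continuous_const.sub ((f α).continuous.comp
            continuous_subtype_val)).abs.continuousAt.eventually_lt continuousAt_const ?_
          simpa using Nat.cast_add_one_pos n
        have h2 : ∀ᶠ j : E in cofinite, d j ∈ O (a, n) := by
          rw [eventually_cofinite]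
          refine ((hEO (a, n)).preimage (f := ((↑) : E → ℕ)) Subtype.val_injective.injOn).subset ?_
          exact fun j hj => ⟨j.2, hj⟩
        obtain ⟨j, hj, k, hkK, hk⟩ := ((mapClusterPt_iff_frequently.1 hq _ h1).and_eventually
          h2).exists
        refine ⟨k, hkK, fun α hα => ?_⟩
        have h3 : |f α q - f α (d j)| < 1 / ((n : ℝ) + 1) := hj α hα
        have h4 : |f α (d j) - f α k| < 1 / ((n : ℝ) + 1) := hk α hα
        calc |f α q - f α k| ≤ |f α q - f α (d j)| + |f α (d j) - f α k| := abs_sub_le _ _ _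
          _ ≤ 1 / ((n : ℝ) + 1) + 1 / ((n : ℝ) + 1) := add_le_add h3.le h4.le
          _ = 2 / ((n : ℝ) + 1) := by ring)
    refine (hf k hk).mono fun α hα => ?_
    have : 0 < f α q := hα
    rwa [hqk α] at this
  · intro α hfin
    refine hEf α ((hfin.image ((↑) : E → ℕ)).subset ?_)
    rintro k ⟨hkE, hk⟩
    exact ⟨⟨k, hkE⟩, hk, rfl⟩

/-- In a hereditarily supercompact space, the closure of a countable set `D` contains no family of
fewer than `𝔭` but uncountably many points `x α` with functions equal to `1` at `x α` that are
point-countable on the closure of the family. -/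
theorem IsHereditarilySupercompact.false_of_pointCountable
    {X : Type*} [TopologicalSpace X] [T2Space X] (hX : IsHereditarilySupercompact X)
    {ι : Type} [Uncountable ι] (hι : #ι < pseudoIntersectionNumber) {D : Set X} (hD : D.Countable)
    (x : ι → X) (hx : ∀ α, x α ∈ closure D) (f : ι → C(X, ℝ)) (hfx : ∀ α, f α (x α) = 1)
    (hf : ∀ q ∈ closure (range x), {α | 0 < f α q}.Countable) : False := by
  have hxD : {α | x α ∈ D}.Countable := by
    by_contra hcon
    have := hD.to_subtype
    obtain ⟨y, hy⟩ := exists_not_countable_setOf_rel hcon (fun α (y : D) => x α = y)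
      fun α hα => ⟨⟨x α, hα⟩, rfl⟩
    have hne : {α ∈ {α | x α ∈ D} | x α = y}.Nonempty := by
      rw [nonempty_iff_ne_empty]
      exact fun h0 => hy (h0 ▸ countable_empty)
    obtain ⟨α, -, hα⟩ := hne
    refine hy ((hf _ (subset_closure (mem_range_self α))).mono ?_)
    rintro β ⟨-, hβ⟩
    change 0 < f β (x α)
    rw [hα, ← hβ, hfx]
    exact one_pos
  obtain ⟨α₀⟩ : Nonempty ι := inferInstance
  obtain ⟨d, rfl⟩ := hD.exists_eq_range (closure_nonempty_iff.1 ⟨_, hx α₀⟩)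
  have : Uncountable {α // x α ∉ range d} := by
    rw [← not_countable_iff]
    intro h
    have huniv := hxD.union h.to_set
    exact not_countable_univ (huniv.mono fun α _ => em (x α ∈ range d))
  refine hX.false_of_mapClusterPt (ι := {α // x α ∉ range d}) ((mk_subtype_le _).trans_lt hι) d
    (fun α => x α) (fun α => mapClusterPt_cofinite_of_notMem_range (hx α) α.2) (fun α => f α)
    (fun α => hfx α) fun q hq => ?_
  exact (hf q (closure_mono (range_comp_subset_range _ x) hq)).preimage Subtype.val_injective

section Recursion

variable {ι : Type*} [LinearOrder ι]

theorem exists_seq_of_forall_countable [WellFoundedLT ι] (hι : ∀ i : ι, (Iio i).Countable)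
    {Y : Type*} (P : Set Y → Y → Prop) (h : ∀ s : Set Y, s.Countable → ∃ y, P s y) :
    ∃ x : ι → Y, ∀ α, P (x '' Iio α) (x α) := by
  have : Nonempty Y := (h ∅ countable_empty).nonempty
  choose! g hg using h
  let x : ι → Y := (wellFounded_lt (α := ι)).fix fun α ih => g (range fun β : Iio α => ih β β.2)
  refine ⟨x, fun α => ?_⟩
  have hx : x α = g (x '' Iio α) := by
    rw [image_eq_range]
    exact (wellFounded_lt (α := ι)).fix_eq _ α
  rw [hx]
  exact hg _ ((hι α).image x)

theorem exists_forall_lt_of_countable [Uncountable ι] (hι : ∀ i : ι, (Iio i).Countable)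
    {s : Set ι} (hs : s.Countable) : ∃ j, ∀ i ∈ s, i < j := by
  by_contra! h
  refine not_countable_univ (α := ι) ((hs.biUnion fun i _ => ((hι i).insert i)).mono ?_)
  intro j _
  obtain ⟨i, hi, hji⟩ := h j
  exact mem_biUnion hi (hji.eq_or_lt.imp id id)

end Recursion

/-- If `p` is in the closure of an `ω₁`-sequence, then countably many nonnegative continuous
functions vanishing at `p` have a common zero in the closure of an initial segment. -/
theorem exists_mem_closure_image_Iio_forall_eq_zero {X ι : Type*} [TopologicalSpace X]
    [CompactSpace X] [LinearOrder ι] [Uncountable ι]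
    (hι : ∀ i : ι, (Iio i).Countable) (x : ι → X) {p : X} (hp : p ∈ closure (range x))
    (g : ℕ → C(X, ℝ)) (hgp : ∀ n, g n p = 0) (hg : ∀ n y, 0 ≤ g n y) :
    ∃ δ, ∃ y ∈ closure (x '' Iio δ), ∀ n, g n y = 0 := by
  have hi : ∀ N : ℕ, ∃ i, ∀ n ∈ Finset.range (N + 1), g n (x i) < 1 / ((N : ℝ) + 1) := by
    intro N
    have h : ∀ᶠ z in 𝓝 p, ∀ n ∈ Finset.range (N + 1), g n z < 1 / ((N : ℝ) + 1) := by
      rw [eventually_all_finset]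
      refine fun n _ => (g n).continuous.continuousAt.eventually_lt continuousAt_const ?_
      rw [hgp]
      exact Nat.one_div_pos_of_nat
    obtain ⟨_, hz, i, rfl⟩ := mem_closure_iff_nhds.1 hp _ h
    exact ⟨i, hz⟩
  choose i hi using hi
  obtain ⟨δ, hδ⟩ := exists_forall_lt_of_countable hι (countable_range i)
  obtain ⟨y, hy, hcl⟩ := (isClosed_closure (s := x '' Iio δ)).isCompact.exists_mapClusterPt
    (f := atTop) (u := fun N => x (i N)) (by
      rw [le_principal_iff, mem_map]
      exact univ_mem' fun N => subset_closure (mem_image_of_mem x (hδ _ (mem_range_self N))))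
  refine ⟨δ, y, hy, fun n => le_antisymm (le_of_forall_gt fun c hc => ?_) (hg n y)⟩
  by_contra! hcy
  have h1 : ∃ᶠ N in atTop, c / 2 < g n (x (i N)) :=
    mapClusterPt_iff_frequently.1 hcl _
      (continuousAt_const.eventually_lt (g n).continuous.continuousAt (by linarith))
  have h2 : ∀ᶠ N : ℕ in atTop, 1 / ((N : ℝ) + 1) < c / 2 :=
    tendsto_one_div_add_atTop_nhds_zero_nat.eventually_lt_const (by linarith)
  obtain ⟨N, hN1, hN2, hN3⟩ := (h1.and_eventually (h2.and (eventually_ge_atTop n))).exists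
  have := hi N n (Finset.mem_range.2 (by omega))
  linarith

section PointCountable

variable {X : Type*} [TopologicalSpace X] [T2Space X] [CompactSpace X]
  {ι : Type*} [LinearOrder ι]

theorem exists_continuousMap_zero_one {p : X} {L : Set X} (hL : IsClosed L) (hp : p ∉ L) :
    ∃ g : C(X, ℝ), g p = 0 ∧ (∀ y ∈ L, g y = 1) ∧ ∀ y, 0 ≤ g y := by
  obtain ⟨g, h0, h1, h⟩ := exists_continuous_zero_one_of_isClosed (isClosed_singleton (x := p)) hL
    (disjoint_singleton_left.2 hp)
  exact ⟨g, h0 rfl, fun y hy => h1 hy, fun y => (h y).1⟩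

/-- If the closures of the initial segments of an `ω₁`-sequence do not exhaust the closure of the
sequence, then their union contains an `ω₁`-sequence that is discrete, witnessed by functions. -/
theorem exists_discrete_seq_of_notMem [WellFoundedLT ι] [Uncountable ι]
    (hι : ∀ i : ι, (Iio i).Countable) (x : ι → X) {p : X} (hp : p ∈ closure (range x))
    (hpx : ∀ α, p ∉ closure (x '' Iio α)) :
    ∃ (y : ι → X) (f : ι → C(X, ℝ)), (∀ α, y α ∈ closure (range x)) ∧ (∀ α, f α (y α) = 1) ∧
      ∀ α β, α ≠ β → f α (y β) = 0 := by
  have hmono : ∀ {α β : ι}, α ≤ β → closure (x '' Iio α) ⊆ closure (x '' Iio β) := fun h =>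
    closure_mono (image_mono (Iio_subset_Iio h))
  choose g hgp hg1 hg0 using fun α => exists_continuousMap_zero_one isClosed_closure (hpx α)
  let Y := {t : X × ι × ι // t.1 ∈ closure (x '' Iio t.2.1) ∧ g t.2.2 t.1 = 0}
  obtain ⟨z, hz⟩ := exists_seq_of_forall_countable hι (Y := Y)
    (fun s t => ∀ u ∈ s, u.1.2.1 ≤ t.1.2.2 ∧ g u.1.2.1 t.1.1 = 0) (by
      intro s hs
      have hs' := hs.image fun u : Y => u.1.2.1
      obtain ⟨ξ, hξ⟩ := exists_forall_lt_of_countable hι hs'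
      obtain ⟨a, ha⟩ := (hs'.insert ξ).exists_eq_range (insert_nonempty _ _)
      obtain ⟨δ, y, hy, hgy⟩ := exists_mem_closure_image_Iio_forall_eq_zero hι x hp
        (fun n => g (a n)) (fun n => hgp _) fun n => hg0 _
      have hA : ∀ i ∈ insert ξ ((fun u : Y => u.1.2.1) '' s), g i y = 0 := by
        rw [ha]
        rintro _ ⟨n, rfl⟩
        exact hgy n
      exact ⟨⟨(y, δ, ξ), hy, hA ξ (mem_insert _ _)⟩, fun u hu =>
        ⟨(hξ _ (mem_image_of_mem _ hu)).le, hA _ (mem_insert_of_mem _ (mem_image_of_mem _ hu))⟩⟩)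
  refine ⟨fun α => (z α).1.1, fun α => g (z α).1.2.1 * (1 - g (z α).1.2.2), fun α => ?_,
    fun α => ?_,
    fun α β hαβ => ?_⟩
  · exact closure_mono (image_subset_range _ _) (z α).2.1
  · simp [hg1 _ _ (z α).2.1, (z α).2.2]
  · rcases lt_or_gt_of_ne hαβ with h | h
    · simp [(hz β _ (mem_image_of_mem z h)).2]
    · simp [hg1 _ _ (hmono (hz α _ (mem_image_of_mem z h)).1 (z β).2.1)]

/-- A subset of a compact space that is not separable yields an `ω₁`-sequence in its closure with
functions equal to `1` at the respective terms that are point-countable on its closure. -/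
theorem exists_pointCountable_seq [WellFoundedLT ι] [Uncountable ι]
    (hι : ∀ i : ι, (Iio i).Countable) {B : Set X}
    (hB : ∀ s ⊆ B, s.Countable → ∃ b ∈ B, b ∉ closure s) :
    ∃ (x : ι → X) (f : ι → C(X, ℝ)), (∀ α, x α ∈ closure B) ∧ (∀ α, f α (x α) = 1) ∧
      ∀ q ∈ closure (range x), {α | 0 < f α q}.Countable := by
  obtain ⟨b, hb⟩ := exists_seq_of_forall_countable hι (Y := B)
    (fun s b => (b : X) ∉ closure (Subtype.val '' s)) fun s hs => by
      obtain ⟨b, hbB, hb⟩ := hB _ (Subtype.coe_image_subset B s) (hs.image _)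
      exact ⟨⟨b, hbB⟩, hb⟩
  let x : ι → X := fun α => b α
  have hx : ∀ α, x α ∉ closure (x '' Iio α) := fun α => by
    simpa only [image_image] using hb α
  have hxB : closure (range x) ⊆ closure B :=
    closure_mono (range_subset_iff.2 fun α => (b α).2)
  by_cases hcase : ∀ q ∈ closure (range x), ∃ α, q ∈ closure (x '' Iio α)
  · choose g hg0 hg1 _ using fun α => exists_continuousMap_zero_one isClosed_closure (hx α)
    refine ⟨x, fun α => 1 - g α, fun α => hxB (subset_closure (mem_range_self α)),
      fun α => by simp [hg0], fun q hq => ?_⟩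
    obtain ⟨β, hβ⟩ := hcase q hq
    refine (hι β).mono fun α hα => ?_
    by_contra hβα
    have h1 := hg1 α q (closure_mono (image_mono (Iio_subset_Iio (not_lt.1 hβα))) hβ)
    have h2 : 0 < (1 - g α) q := hα
    simp [h1] at h2
  · push Not at hcase
    obtain ⟨p, hp, hpx⟩ := hcase
    obtain ⟨y, f, hy, hfy, hf⟩ := exists_discrete_seq_of_notMem hι x hp hpx
    refine ⟨y, f, fun α => hxB (hy α), hfy, fun q hq => Set.Subsingleton.countable ?_⟩
    intro α hα β hβ
    by_contra hne
    have hnhds : {z | 0 < f α z} ∩ {z | 0 < f β z} ∈ 𝓝 q :=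
      inter_mem ((isOpen_lt continuous_const (f α).continuous).mem_nhds hα)
        ((isOpen_lt continuous_const (f β).continuous).mem_nhds hβ)
    obtain ⟨_, ⟨h1, h2⟩, γ, rfl⟩ := mem_closure_iff_nhds.1 hq _ hnhds
    have h1 : 0 < f α (y γ) := h1
    have h2 : 0 < f β (y γ) := h2
    by_cases hαγ : α = γ
    · exact h2.ne' (hf β γ fun h => hne (hαγ.trans h.symm))
    · exact h1.ne' (hf α γ hαγ)

end PointCountable

/-- Under `ω₁ < 𝔭`, every hereditarily supercompact Hausdorff space is sub-hereditarily
separable: each of its separable subspaces is hereditarily separable. -/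
theorem subHereditarilySeparable_of_hereditarilySupercompact
    (hp : Cardinal.aleph 1 < pseudoIntersectionNumber)
    (X : Type u) [TopologicalSpace X] [T2Space X]
    (hX : IsHereditarilySupercompact X)
    (A : Set X) (hA : TopologicalSpace.SeparableSpace A) :
    ∀ B : Set A, TopologicalSpace.SeparableSpace B := by
  intro B
  by_contra hBsep
  have := hX.compactSpace
  let φ : B → X := fun b => b.1.1
  have hφ : IsInducing φ := IsInducing.subtypeVal.comp IsInducing.subtypeVal
  have hφinj : Function.Injective φ := Subtype.val_injective.comp Subtype.val_injective
  obtain ⟨D, hD, hDd⟩ := exists_countable_dense A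
  have hBD : closure (range φ) ⊆ closure (Subtype.val '' D) :=
    closure_minimal (range_subset_iff.2 fun b => closure_subtype.1 (hDd b.1)) isClosed_closure
  have hcard : #(Cardinal.aleph 1).ord.ToType = Cardinal.aleph 1 := mk_ord_toType _
  have hunc : Uncountable (Cardinal.aleph 1).ord.ToType := by
    rw [← aleph0_lt_mk_iff, hcard]
    exact aleph0_lt_aleph_one
  have hIio : ∀ i : (Cardinal.aleph 1).ord.ToType, (Iio i).Countable := by
    intro i
    rw [← le_aleph0_iff_set_countable, ← lt_aleph_one_iff]
    simpa using mk_Iio_lt i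
  obtain ⟨x, f, hx, hfx, hf⟩ := exists_pointCountable_seq hIio (B := range φ) (by
    intro s hs hsc
    by_contra! hcon
    refine hBsep ⟨φ ⁻¹' s, hsc.preimage hφinj, fun b => ?_⟩
    rw [hφ.closure_eq_preimage_closure_image, image_preimage_eq_of_subset hs]
    exact hcon _ (mem_range_self b))
  exact hX.false_of_pointCountable (hcard.trans_lt hp) (hD.image _) x (fun α => hBD (hx α)) f hfx hf
end
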